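/- Let (A_i)_{i∈N̂} be an approval profile over candidates Ĉ with at most 5 distinct approval sets, and k a committee size. Then there exists W ⊆ Ĉ with |W| ≤ k such that no non-empty coalition S ⊆ N̂ and set T ⊆ Ĉ satisfy |T| ≤ (|S|/|N̂|)·k and |A_i ∩ T| > |A_i ∩ W| for all i ∈ S. -/

import Mathlib

/-- Rounding property for fractional vectors with total `k`. -/
def Rnd (α : Type*) [Fintype α] [DecidableEq α] (k : ℕ) : Prop :=
  ∀ (y : α → ℝ) (D : Fin 5 → Finset α) (m : Fin 5 → ℤ),
    (∀ a, 0 < y a) → (∀ a, y a < 1) → (∑ a, y a = k) →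
    (∀ i, (m i : ℝ) ≤ ∑ a ∈ D i, y a) →
    ∃ U : Finset α, U.card = k ∧ ∀ i, m i ≤ ((U ∩ D i).card : ℤ)

theorem Rnd.zero (α : Type*) [Fintype α] [DecidableEq α] : Rnd α 0 := by
  intro y D m h0 h1 hs hm
  refine ⟨∅, rfl, fun i => ?_⟩
  have : (∑ a ∈ D i, y a) ≤ ∑ a, y a :=
    Finset.sum_le_sum_of_subset_of_nonneg (Finset.subset_univ _) (fun a _ _ => (h0 a).le)
  have h2 : (m i : ℝ) ≤ 0 := by
    have := hm i
    simp at hs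
    linarith
  simp
  exact_mod_cast h2

theorem Rnd.one (α : Type*) [Fintype α] [DecidableEq α] : Rnd α 1 := by
  intro y D m h0 h1 hs hm
  have hne : Nonempty α := by
    by_contra h
    rw [not_nonempty_iff] at h
    simp at hs
  obtain ⟨a⟩ := hne
  refine ⟨{a}, by simp, fun i => ?_⟩
  have hle : (∑ a ∈ D i, y a) ≤ ∑ a, y a :=
    Finset.sum_le_sum_of_subset_of_nonneg (Finset.subset_univ _) (fun a _ _ => (h0 a).le)
  have hmi := hm i
  by_cases ha : a ∈ D i
  · have : ({a} ∩ D i) = {a} := by simpa using ha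
    rw [this]
    have h2 : (m i : ℝ) ≤ 1 := by push_cast at hs; linarith
    simp
    exact_mod_cast h2
  · have h3 : (∑ b ∈ insert a (D i), y b) ≤ ∑ a, y a :=
      Finset.sum_le_sum_of_subset_of_nonneg (Finset.subset_univ _) (fun a _ _ => (h0 a).le)
    rw [Finset.sum_insert ha] at h3
    have h2 : (m i : ℝ) < 1 := by push_cast at hs; linarith [h0 a]
    have h4 : m i < 1 := by exact_mod_cast h2
    have : (0 : ℤ) ≤ (({a} ∩ D i).card : ℤ) := by positivity
    omega

theorem Rnd.two (α : Type*) [Fintype α] [DecidableEq α] : Rnd α 2 := by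
  intro y D m h0 h1 hs hm
  by_contra hcon
  push Not at hcon
  push_cast at hs
  -- total over the complement
  have hcompl : ∀ i, ∑ a ∈ (D i)ᶜ, y a = 2 - ∑ a ∈ D i, y a := by
    intro i
    have := Finset.sum_add_sum_compl (D i) y
    linarith
  -- voters with demand one
  set e : α → Finset (Fin 5) := fun a => Finset.univ.filter (fun i => m i = 1 ∧ a ∉ D i) with he
  have key : ∀ a b, a ≠ b → (e a ∩ e b).Nonempty := by
    intro a b hab
    obtain ⟨i, hi⟩ := hcon {a, b} (Finset.card_pair hab)
    refine ⟨i, ?_⟩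
    have hmi := hm i
    have hci := hcompl i
    have hpos : 0 ≤ ∑ a ∈ (D i)ᶜ, y a := Finset.sum_nonneg (fun a _ => (h0 a).le)
    have hm2 : (m i : ℝ) ≤ 2 := by linarith
    have hm2' : m i ≤ 2 := by exact_mod_cast hm2
    have hne2 : m i ≠ 2 := by
      intro h2
      have h2' : (m i : ℝ) = 2 := by exact_mod_cast h2
      have hz : ∑ a ∈ (D i)ᶜ, y a = 0 := by linarith
      have hall : ∀ c, c ∈ D i := by
        intro c
        by_contra hc
        have := (Finset.sum_eq_zero_iff_of_nonneg (fun a _ => (h0 a).le)).1 hz c (by simpa using hc)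
        linarith [h0 c]
      have : ({a, b} ∩ D i) = {a, b} := by
        apply Finset.inter_eq_left.2
        intro c _
        exact hall c
      rw [this, Finset.card_pair hab] at hi
      push_cast at hi
      omega
    have hn : (0 : ℤ) ≤ (({a, b} ∩ D i).card : ℤ) := by positivity
    have h1' : m i = 1 := by omega
    have h0' : ({a, b} ∩ D i).card = 0 := by omega
    rw [Finset.card_eq_zero] at h0'
    have ha : a ∉ D i := fun h => by
      have : a ∈ ({a, b} ∩ D i) := by simp [h]
      rw [h0'] at this; simp at this
    have hb : b ∉ D i := fun h => by
      have : b ∈ ({a, b} ∩ D i) := by simp [h]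
      rw [h0'] at this; simp at this
    simp [he, h1', ha, hb]
  have hbig : ∀ a : α, ∃ b : α, a ≠ b := by
    intro a
    by_contra h
    push Not at h
    have : ∑ b, y b = y a := by
      apply Finset.sum_eq_single
      · intro b _ hb; exact absurd (h b).symm hb
      · simp
    linarith [h1 a]
  have hne : ∀ a, (e a).Nonempty := by
    intro a
    obtain ⟨b, hb⟩ := hbig a
    exact (key a b hb).mono Finset.inter_subset_left
  have key' : ∀ a b, (e a ∩ e b).Nonempty := by
    intro a b
    by_cases h : a = b
    · subst h; simpa using hne a
    · exact key a b h
  -- double counting against a set of voters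
  have dc : ∀ S : Finset (Fin 5), ∑ b, y b * ((S ∩ e b).card : ℝ) ≤ S.card := by
    intro S
    have h1 : ∀ b, y b * ((S ∩ e b).card : ℝ) = ∑ i ∈ S, if m i = 1 ∧ b ∉ D i then y b else 0 := by
      intro b
      rw [← Finset.sum_filter, Finset.sum_const, nsmul_eq_mul, mul_comm]
      congr 3
      ext i
      simp [he]
    rw [Finset.sum_congr rfl (fun b _ => h1 b), Finset.sum_comm]
    have : ∀ i ∈ S, (∑ b, if m i = 1 ∧ b ∉ D i then y b else 0) ≤ (1 : ℝ) := by
      intro i _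
      by_cases hmi : m i = 1
      · have : (∑ b, if m i = 1 ∧ b ∉ D i then y b else 0) = ∑ a ∈ (D i)ᶜ, y a := by
          rw [← Finset.sum_filter]
          apply Finset.sum_congr _ (fun _ _ => rfl)
          ext b
          simp [hmi]
        rw [this, hcompl i]
        have h2 := hm i
        rw [hmi] at h2
        push_cast at h2
        linarith
      · simp [hmi]
    calc _ ≤ ∑ i ∈ S, (1 : ℝ) := Finset.sum_le_sum this
      _ = _ := by simp
  obtain ⟨a, ha⟩ : ∃ a, (e a).card ≤ 2 := by
    by_contra h
    push Not at h
    have h5 := dc Finset.univ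
    have h6 : ∑ b, y b * 3 ≤ ∑ b, y b * (((Finset.univ ∩ e b).card : ℕ) : ℝ) := by
      apply Finset.sum_le_sum
      intro b _
      apply mul_le_mul_of_nonneg_left _ (h0 b).le
      have := h b
      rw [Finset.univ_inter]
      exact_mod_cast this
    rw [← Finset.sum_mul, hs] at h6
    simp at h5 h6
    linarith
  have h7 := dc (e a)
  have h8 : ∑ b, y b ≤ ∑ b, y b * ((e a ∩ e b).card : ℝ) := by
    apply Finset.sum_le_sum
    intro b _
    have : (1 : ℝ) ≤ ((e a ∩ e b).card : ℝ) := by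
      have := Finset.card_pos.2 (key' a b)
      exact_mod_cast this
    nlinarith [h0 b]
  have ha2 : (e a).card = 2 := by
    have : (2 : ℝ) ≤ (e a).card := by linarith
    have : 2 ≤ (e a).card := by exact_mod_cast this
    omega
  have h9 : ∑ b, y b < ∑ b, y b * ((e a ∩ e b).card : ℝ) := by
    apply Finset.sum_lt_sum
    · intro b _
      have : (1 : ℝ) ≤ ((e a ∩ e b).card : ℝ) := by
        have := Finset.card_pos.2 (key' a b)
        exact_mod_cast this
      nlinarith [h0 b]
    · refine ⟨a, Finset.mem_univ _, ?_⟩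
      rw [Finset.inter_self, ha2]
      push_cast
      linarith [h0 a]
  rw [ha2] at h7
  push_cast at h7
  linarith

theorem Rnd.dual (α : Type*) [Fintype α] [DecidableEq α] (k l : ℕ) (hkl : k + l = Fintype.card α)
    (h : Rnd α l) : Rnd α k := by
  intro y D m h0 h1 hs hm
  have hcr : (k : ℝ) + l = Fintype.card α := by exact_mod_cast hkl
  have hDc : ∀ i, ((D i).card : ℤ) + ((D i)ᶜ.card : ℤ) = k + l := by
    intro i
    have := Finset.card_add_card_compl (D i)
    rw [← hkl] at this
    exact_mod_cast this
  obtain ⟨U, hU, hUi⟩ := h (fun a => 1 - y a) (fun i => (D i)ᶜ) (fun i => m i + l - (D i).card)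
    (fun a => by linarith [h1 a]) (fun a => by linarith [h0 a])
    (by simp; linarith) (by
      intro i
      have h2 := Finset.sum_add_sum_compl (D i) y
      have h3 : (((D i).card : ℤ) : ℝ) + (((D i)ᶜ.card : ℤ) : ℝ) = k + l := by exact_mod_cast hDc i
      simp only [Finset.sum_sub_distrib]
      have := hm i
      push_cast at *
      simp
      linarith)
  refine ⟨Uᶜ, by rw [Finset.card_compl]; omega, fun i => ?_⟩
  have h2 := hUi i
  have h3 : (U ∩ (D i)ᶜ).card + (U ∩ D i).card = U.card := by
    rw [← Finset.sdiff_eq_inter_compl]; exact Finset.card_sdiff_add_card_inter U (D i)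
  have h4 : (D i ∩ Uᶜ).card + (D i ∩ U).card = (D i).card := by
    rw [← Finset.sdiff_eq_inter_compl]; exact Finset.card_sdiff_add_card_inter (D i) U
  rw [Finset.inter_comm (D i), Finset.inter_comm (D i)] at h4
  beta_reduce at h2
  omega

theorem Rnd.congr {α β : Type*} [Fintype α] [DecidableEq α] [Fintype β] [DecidableEq β]
    (f : α ≃ β) (k : ℕ) (h : Rnd β k) : Rnd α k := by
  intro y D m h0 h1 hs hm
  obtain ⟨U, hU, hUi⟩ := h (fun b => y (f.symm b)) (fun i => (D i).map f.toEmbedding) m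
    (fun b => h0 _) (fun b => h1 _) (by rw [← hs]; exact Equiv.sum_comp f.symm y)
    (by intro i; simpa using hm i)
  refine ⟨U.map f.symm.toEmbedding, by simpa using hU, fun i => ?_⟩
  have h2 := hUi i
  have : (U.map f.symm.toEmbedding ∩ D i) = (U ∩ (D i).map f.toEmbedding).map f.symm.toEmbedding := by
    ext a
    simp [Finset.mem_map_equiv]
  rw [this, Finset.card_map]
  exact h2

section sixthree

/-- The three-element subsets of `Fin 6`. -/
def T3 : Finset (Finset (Fin 6)) := Finset.powersetCard 3 Finset.univ

/-- The committees in `Q` violating the demand `(D, m)`. -/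
def kill (D : Finset (Fin 6)) (m : ℕ) (Q : Finset (Finset (Fin 6))) : Finset (Finset (Fin 6)) :=
  Q.filter (fun U => (U ∩ D).card < m)

/-- The triples sharing exactly two elements with `X`. -/
def sw (X : Finset (Fin 6)) : Finset (Finset (Fin 6)) := T3.filter (fun U => (U ∩ X).card = 2)

set_option maxRecDepth 100000

theorem T3_card : T3.card = 20 := by decide +kernel

theorem sw_card : ∀ X ∈ T3, (sw X).card = 9 := by decide +kernel

theorem kill1_le : ∀ D : Finset (Fin 6), 2 ≤ D.card → (kill D 1 T3).card ≤ 4 := by decide +kernel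

theorem kill2_le : ∀ D : Finset (Fin 6), 4 ≤ D.card → (kill D 2 T3).card ≤ 4 := by decide +kernel

theorem kill1_eq : ∀ D : Finset (Fin 6), (kill D 1 T3).card = 4 → D.card = 2 := by decide +kernel

theorem kill2_eq : ∀ D : Finset (Fin 6), (kill D 2 T3).card = 4 → D.card = 4 := by decide +kernel

theorem dis11 : ∀ a ∈ Finset.powersetCard 2 (Finset.univ : Finset (Fin 6)),
    ∀ b ∈ Finset.powersetCard 2 (Finset.univ : Finset (Fin 6)),
    Disjoint (kill a 1 T3) (kill b 1 T3) → a ∩ b = ∅ := by decide +kernel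

theorem dis12 : ∀ a ∈ Finset.powersetCard 2 (Finset.univ : Finset (Fin 6)),
    ∀ b ∈ Finset.powersetCard 4 (Finset.univ : Finset (Fin 6)),
    Disjoint (kill a 1 T3) (kill b 2 T3) → ¬ a ⊆ b := by decide +kernel

theorem dis22 : ∀ a ∈ Finset.powersetCard 4 (Finset.univ : Finset (Fin 6)),
    ∀ b ∈ Finset.powersetCard 4 (Finset.univ : Finset (Fin 6)),
    Disjoint (kill a 2 T3) (kill b 2 T3) → a ∪ b = Finset.univ := by decide +kernel

set_option synthInstance.maxHeartbeats 400000
set_option synthInstance.maxSize 2000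

theorem no1a : ∀ a ∈ Finset.powersetCard 2 (Finset.univ : Finset (Fin 6)),
    ∀ b ∈ Finset.powersetCard 2 (Finset.univ : Finset (Fin 6)), a ∩ b = ∅ →
    ∀ c ∈ Finset.powersetCard 2 (Finset.univ : Finset (Fin 6)), (a ∩ c = ∅ ∧ b ∩ c = ∅) →
    ∀ d ∈ Finset.powersetCard 2 (Finset.univ : Finset (Fin 6)),
      ¬ (a ∩ d = ∅ ∧ b ∩ d = ∅ ∧ c ∩ d = ∅) := by decide +kernel

theorem no1b : ∀ a ∈ Finset.powersetCard 2 (Finset.univ : Finset (Fin 6)),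
    ∀ b ∈ Finset.powersetCard 2 (Finset.univ : Finset (Fin 6)), a ∩ b = ∅ →
    ∀ c ∈ Finset.powersetCard 2 (Finset.univ : Finset (Fin 6)), (a ∩ c = ∅ ∧ b ∩ c = ∅) →
    ∀ d ∈ Finset.powersetCard 4 (Finset.univ : Finset (Fin 6)),
      ¬ (¬ a ⊆ d ∧ ¬ b ⊆ d ∧ ¬ c ⊆ d) := by decide +kernel

theorem no2a : ∀ a ∈ Finset.powersetCard 4 (Finset.univ : Finset (Fin 6)),
    ∀ b ∈ Finset.powersetCard 4 (Finset.univ : Finset (Fin 6)), a ∪ b = Finset.univ →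
    ∀ c ∈ Finset.powersetCard 4 (Finset.univ : Finset (Fin 6)), (a ∪ c = Finset.univ ∧ b ∪ c = Finset.univ) →
    ∀ d ∈ Finset.powersetCard 4 (Finset.univ : Finset (Fin 6)),
      ¬ (a ∪ d = Finset.univ ∧ b ∪ d = Finset.univ ∧ c ∪ d = Finset.univ) := by decide +kernel

theorem no2b : ∀ a ∈ Finset.powersetCard 4 (Finset.univ : Finset (Fin 6)),
    ∀ b ∈ Finset.powersetCard 4 (Finset.univ : Finset (Fin 6)), a ∪ b = Finset.univ →
    ∀ c ∈ Finset.powersetCard 4 (Finset.univ : Finset (Fin 6)), (a ∪ c = Finset.univ ∧ b ∪ c = Finset.univ) →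
    ∀ d ∈ Finset.powersetCard 2 (Finset.univ : Finset (Fin 6)),
      ¬ (¬ d ⊆ a ∧ ¬ d ⊆ b ∧ ¬ d ⊆ c) := by decide +kernel

theorem sw1 : ∀ X ∈ T3, ∀ D : Finset (Fin 6), 2 ≤ D.card → (D ∩ X = ∅ → D = Xᶜ) →
    (kill D 1 (sw X)).card ≤ 2 := by decide +kernel

theorem sw1' : ∀ X ∈ T3, kill Xᶜ 1 (sw X) = ∅ := by decide +kernel

theorem sw2 : ∀ X ∈ T3, ∀ D : Finset (Fin 6), 4 ≤ D.card → 2 ≤ (X ∩ D).card →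
    (kill D 2 (sw X)).card ≤ 2 := by decide +kernel

theorem sw2' : ∀ X ∈ T3, kill X 2 (sw X) = ∅ := by decide +kernel

theorem sw3 : ∀ X ∈ T3, ∀ D ∈ T3, 2 ≤ (X ∩ D).card →
    (kill D 2 (sw X)).card ≤ 4 := by decide +kernel

theorem mem_T3 (X : Finset (Fin 6)) : X ∈ T3 ↔ X.card = 3 := by
  simp [T3, Finset.mem_powersetCard]

theorem mem_kill (D : Finset (Fin 6)) (m : ℕ) (Q : Finset (Finset (Fin 6))) (U : Finset (Fin 6)) :
    U ∈ kill D m Q ↔ U ∈ Q ∧ (U ∩ D).card < m := by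
  simp [kill]

/-- Case without a strong demand, purely combinatorial. -/
theorem caseA (E : Fin 5 → Finset (Fin 6)) (n : Fin 5 → ℕ) (hn : ∀ i, n i = 1 ∨ n i = 2)
    (h1 : ∀ i, n i = 1 → 2 ≤ (E i).card) (h2 : ∀ i, n i = 2 → 4 ≤ (E i).card)
    (hcov : ∀ U ∈ T3, ∃ i, (U ∩ E i).card < n i) : False := by
  set K : Fin 5 → Finset (Finset (Fin 6)) := fun i => kill (E i) (n i) T3 with hK
  have hK4 : ∀ i, (K i).card ≤ 4 := by
    intro i
    rcases hn i with h | h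
    · simp only [hK, h]; exact kill1_le _ (h1 i h)
    · simp only [hK, h]; exact kill2_le _ (h2 i h)
  have hsub : T3 ⊆ Finset.univ.biUnion K := by
    intro U hU
    obtain ⟨i, hi⟩ := hcov U hU
    exact Finset.mem_biUnion.2 ⟨i, Finset.mem_univ _, (mem_kill _ _ _ _).2 ⟨hU, hi⟩⟩
  have h20 : ∀ i, (K i).card = 4 := by
    intro i
    by_contra hne
    have hlt : (K i).card < 4 := lt_of_le_of_ne (hK4 i) hne
    have a1 := Finset.card_le_card hsub
    have a2 : (Finset.univ.biUnion K).card ≤ ∑ i, (K i).card := Finset.card_biUnion_le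
    have a3 : ∑ i, (K i).card < ∑ _i : Fin 5, 4 :=
      Finset.sum_lt_sum (fun j _ => hK4 j) ⟨i, Finset.mem_univ _, hlt⟩
    rw [T3_card] at a1
    simp at a3
    omega
  have hdis : ∀ i j, i ≠ j → Disjoint (K i) (K j) := by
    intro i j hij
    by_contra hnd
    have a1 := Finset.card_le_card hsub
    have hun : Finset.univ.biUnion K ⊆
        (K i ∪ K j) ∪ ((Finset.univ.erase i).erase j).biUnion K := by
      intro U hU
      obtain ⟨l, _, hl⟩ := Finset.mem_biUnion.1 hU
      by_cases hli : l = i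
      · subst hli; simp [hl]
      by_cases hlj : l = j
      · subst hlj; simp [hl]
      apply Finset.mem_union_right
      exact Finset.mem_biUnion.2 ⟨l, by simp [hli, hlj], hl⟩
    have a2 := Finset.card_le_card hun
    have a3 := Finset.card_union_le (K i ∪ K j) (((Finset.univ.erase i).erase j).biUnion K)
    have a4 : (((Finset.univ.erase i).erase j).biUnion K).card ≤
        ((Finset.univ.erase i).erase j).card * 4 :=
      Finset.card_biUnion_le_card_mul _ _ _ (fun l _ => hK4 l)
    have a5 : ((Finset.univ.erase i).erase j).card = 3 := by
      rw [Finset.card_erase_of_mem (by simp [hij.symm]), Finset.card_erase_of_mem (by simp)]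
      simp
    have a6 := Finset.card_union_add_card_inter (K i) (K j)
    have a7 : 0 < (K i ∩ K j).card := by
      rw [Finset.card_pos]
      rw [Finset.disjoint_iff_inter_eq_empty] at hnd
      exact Finset.nonempty_iff_ne_empty.2 hnd
    rw [T3_card] at a1
    have := h20 i
    have := h20 j
    omega
  have e1 : ∀ i, n i = 1 → E i ∈ Finset.powersetCard 2 (Finset.univ : Finset (Fin 6)) := by
    intro i h
    have := h20 i
    simp only [hK, h] at this
    simpa [Finset.mem_powersetCard] using kill1_eq _ this
  have e2 : ∀ i, n i = 2 → E i ∈ Finset.powersetCard 4 (Finset.univ : Finset (Fin 6)) := by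
    intro i h
    have := h20 i
    simp only [hK, h] at this
    simpa [Finset.mem_powersetCard] using kill2_eq _ this
  have d11 : ∀ i j, i ≠ j → n i = 1 → n j = 1 → E i ∩ E j = ∅ := by
    intro i j hij hi hj
    have := hdis i j hij
    simp only [hK, hi, hj] at this
    exact dis11 _ (e1 i hi) _ (e1 j hj) this
  have d12 : ∀ i j, i ≠ j → n i = 1 → n j = 2 → ¬ E i ⊆ E j := by
    intro i j hij hi hj
    have := hdis i j hij
    simp only [hK, hi, hj] at this
    exact dis12 _ (e1 i hi) _ (e2 j hj) this
  have d22 : ∀ i j, i ≠ j → n i = 2 → n j = 2 → E i ∪ E j = Finset.univ := by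
    intro i j hij hi hj
    have := hdis i j hij
    simp only [hK, hi, hj] at this
    exact dis22 _ (e2 i hi) _ (e2 j hj) this
  have hfour : ∀ i j k : Fin 5, ∃ l, l ≠ i ∧ l ≠ j ∧ l ≠ k := by decide
  have hpig : 2 < (Finset.univ.filter (fun i => n i = 1)).card ∨
      2 < (Finset.univ.filter (fun i => n i = 2)).card := by
    have hu : (Finset.univ : Finset (Fin 5)) ⊆
        Finset.univ.filter (fun i => n i = 1) ∪ Finset.univ.filter (fun i => n i = 2) := by
      intro i _
      simpa using hn i
    have b1 := Finset.card_le_card hu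
    have b2 := Finset.card_union_le (Finset.univ.filter (fun i => n i = 1))
      (Finset.univ.filter (fun i => n i = 2))
    simp only [Finset.card_univ, Fintype.card_fin] at b1
    omega
  rcases hpig with h | h
  · obtain ⟨i, hi, j, hj, k, hk, hij, hik, hjk⟩ := Finset.two_lt_card.1 h
    simp only [Finset.mem_filter, Finset.mem_univ, true_and] at hi hj hk
    obtain ⟨l, hli, hlj, hlk⟩ := hfour i j k
    rcases hn l with hl | hl
    · exact no1a _ (e1 i hi) _ (e1 j hj) (d11 i j hij hi hj) _ (e1 k hk)
        ⟨d11 i k hik hi hk, d11 j k hjk hj hk⟩ _ (e1 l hl)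
        ⟨d11 i l hli.symm hi hl, d11 j l hlj.symm hj hl, d11 k l hlk.symm hk hl⟩
    · exact no1b _ (e1 i hi) _ (e1 j hj) (d11 i j hij hi hj) _ (e1 k hk)
        ⟨d11 i k hik hi hk, d11 j k hjk hj hk⟩ _ (e2 l hl)
        ⟨d12 i l hli.symm hi hl, d12 j l hlj.symm hj hl, d12 k l hlk.symm hk hl⟩
  · obtain ⟨i, hi, j, hj, k, hk, hij, hik, hjk⟩ := Finset.two_lt_card.1 h
    simp only [Finset.mem_filter, Finset.mem_univ, true_and] at hi hj hk
    obtain ⟨l, hli, hlj, hlk⟩ := hfour i j k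
    rcases hn l with hl | hl
    · exact no2b _ (e2 i hi) _ (e2 j hj) (d22 i j hij hi hj) _ (e2 k hk)
        ⟨d22 i k hik hi hk, d22 j k hjk hj hk⟩ _ (e1 l hl)
        ⟨d12 l i hli hl hi, d12 l j hlj hl hj, d12 l k hlk hl hk⟩
    · exact no2a _ (e2 i hi) _ (e2 j hj) (d22 i j hij hi hj) _ (e2 k hk)
        ⟨d22 i k hik hi hk, d22 j k hjk hj hk⟩ _ (e2 l hl)
        ⟨d22 i l hli.symm hi hl, d22 j l hlj.symm hj hl, d22 k l hlk.symm hk hl⟩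

/-- Case with a strong demand, combinatorial part. -/
theorem caseB (E : Fin 5 → Finset (Fin 6)) (n : Fin 5 → ℕ) (hn : ∀ i, n i = 1 ∨ n i = 2)
    (h1 : ∀ i, n i = 1 → 2 ≤ (E i).card) (h2 : ∀ i, n i = 2 → 3 ≤ (E i).card)
    (h22 : ∀ i j, n i = 2 → (E i).card = 3 → n j = 2 → 2 ≤ (E i ∩ E j).card)
    (h21 : ∀ i j, n i = 2 → (E i).card = 3 → n j = 1 → E j ∩ E i = ∅ → E j = (E i)ᶜ)
    (i0 : Fin 5) (hi0 : n i0 = 2) (hX : (E i0).card = 3)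
    (hcov : ∀ U ∈ T3, ∃ i, (U ∩ E i).card < n i) : False := by
  have hc : ∀ i, n i = 2 → (E i).card = 3 → ∃ j, n j = 1 ∧ E j = (E i)ᶜ := by
    intro i hi hc
    obtain ⟨j, hj⟩ := hcov (E i) ((mem_T3 _).2 hc)
    rcases hn j with h | h
    · refine ⟨j, h, h21 i j hi hc h ?_⟩
      rw [h] at hj
      rw [Finset.inter_comm]
      exact Finset.card_eq_zero.1 (by omega)
    · have := h22 i j hi hc h
      omega
  have hXT := (mem_T3 _).2 hX
  set X := E i0 with hXdef
  set Q := sw X with hQ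
  have hQ9 : Q.card = 9 := sw_card X hXT
  have hQT : Q ⊆ T3 := Finset.filter_subset _ _
  set K : Fin 5 → Finset (Finset (Fin 6)) := fun i => kill (E i) (n i) Q with hK
  obtain ⟨i1, hi1, hE1⟩ := hc i0 hi0 hX
  have hcovQ : ∀ U ∈ Q, ∃ i, U ∈ K i := by
    intro U hU
    obtain ⟨i, hi⟩ := hcov U (hQT hU)
    exact ⟨i, (mem_kill _ _ _ _).2 ⟨hU, hi⟩⟩
  have hKX : ∀ i, n i = 2 → E i = X → K i = ∅ := by
    intro i hi hE
    simp only [hK, hi, hE]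
    exact sw2' X hXT
  have hKXc : ∀ i, n i = 1 → E i = Xᶜ → K i = ∅ := by
    intro i hi hE
    simp only [hK, hi, hE]
    exact sw1' X hXT
  have hKw : ∀ i, ¬ (n i = 2 ∧ (E i).card = 3) → (K i).card ≤ 2 := by
    intro i hi
    rcases hn i with h | h
    · simp only [hK, h]
      exact sw1 X hXT _ (h1 i h) (h21 i0 i hi0 hX h)
    · simp only [hK, h]
      apply sw2 X hXT _ _ (h22 i0 i hi0 hX h)
      have := h2 i h
      have : (E i).card ≠ 3 := fun h' => hi ⟨h, h'⟩
      omega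
  have hi01 : i0 ≠ i1 := by
    intro h; rw [h] at hi0; omega
  by_cases hs : ∃ i, n i = 2 ∧ (E i).card = 3 ∧ E i ≠ X
  · obtain ⟨i2, hi2, hY, hne⟩ := hs
    obtain ⟨i3, hi3, hE3⟩ := hc i2 hi2 hY
    have hKY : (K i2).card ≤ 4 := by
      simp only [hK, hi2]
      exact sw3 X hXT _ ((mem_T3 _).2 hY) (h22 i0 i2 hi0 hX hi2)
    have hcl : ∀ i, n i = 2 → (E i).card = 3 → E i = X ∨ E i = E i2 := by
      intro i hi hZ
      by_contra hcon
      push Not at hcon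
      obtain ⟨i5, hi5, hE5⟩ := hc i hi hZ
      have hnd : [i0, i1, i2, i3, i, i5].Nodup := by
        have g : ∀ a b, n a = 2 → n b = 1 → a ≠ b := by
          intro a b ha hb hab; rw [hab] at ha; omega
        have q1 : i0 ≠ i2 := fun h => hne (by rw [← h])
        have q2 : i0 ≠ i := fun h => hcon.1 (by rw [← h])
        have q3 : i2 ≠ i := fun h => hcon.2 (by rw [← h])
        have q4 : i1 ≠ i3 := fun h => hne (by
          rw [h, hE3] at hE1; exact compl_injective hE1)
        have q5 : i1 ≠ i5 := fun h => hcon.1 (by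
          rw [h, hE5] at hE1; exact compl_injective hE1)
        have q6 : i3 ≠ i5 := fun h => hcon.2 (by
          rw [h, hE5] at hE3; exact compl_injective hE3)
        simp [hi01, q1, q2, q3, q4, q5, q6, g i0 i3 hi0 hi3, g i0 i5 hi0 hi5,
          (g i2 i1 hi2 hi1).symm, (g i i1 hi hi1).symm, g i2 i3 hi2 hi3, g i2 i5 hi2 hi5,
          (g i i3 hi hi3).symm, g i i5 hi hi5]
      have := hnd.length_le_card
      simp at this
    have hi02 : i0 ≠ i2 := fun h => hne (by rw [← h])
    have hi12 : i1 ≠ i2 := by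
      intro h; rw [h] at hi1; omega
    set R : Finset (Fin 5) := ((Finset.univ.erase i0).erase i1).erase i2 with hR
    have hRc : R.card = 2 := by
      rw [hR, Finset.card_erase_of_mem (by simp [hi02.symm, hi12.symm]),
        Finset.card_erase_of_mem (by simp [hi01.symm]), Finset.card_erase_of_mem (by simp)]
      simp
    set L : Fin 5 → Finset (Finset (Fin 6)) :=
      fun i => if n i = 2 ∧ (E i).card = 3 then ∅ else K i with hL
    have hL2 : ∀ i ∈ R, (L i).card ≤ 2 := by
      intro i _
      simp only [hL]
      split_ifs with h
      · simp
      · exact hKw i h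
    have hsub : Q ⊆ K i2 ∪ R.biUnion L := by
      intro U hU
      obtain ⟨i, hi⟩ := hcovQ U hU
      by_cases hst : n i = 2 ∧ (E i).card = 3
      · rcases hcl i hst.1 hst.2 with h | h
        · rw [hKX i hst.1 h] at hi; simp at hi
        · apply Finset.mem_union_left
          have : K i = K i2 := by simp only [hK, h, hi2, hst.1]
          rwa [this] at hi
      · apply Finset.mem_union_right
        refine Finset.mem_biUnion.2 ⟨i, ?_, ?_⟩
        · have q0 : i ≠ i0 := fun h => hst (by rw [h]; exact ⟨hi0, hX⟩)
          have q2 : i ≠ i2 := fun h => hst (by rw [h]; exact ⟨hi2, hY⟩)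
          have q1 : i ≠ i1 := fun h => by
            rw [h, hKXc i1 hi1 hE1] at hi; simp at hi
          simp [hR, q0, q1, q2]
        · simp only [hL, if_neg hst]; exact hi
    have a1 := Finset.card_le_card hsub
    have a2 := Finset.card_union_le (K i2) (R.biUnion L)
    have a3 := Finset.card_biUnion_le_card_mul _ _ _ hL2
    omega
  · push Not at hs
    set R : Finset (Fin 5) := (Finset.univ.erase i0).erase i1 with hR
    have hRc : R.card = 3 := by
      rw [hR, Finset.card_erase_of_mem (by simp [hi01.symm]), Finset.card_erase_of_mem (by simp)]
      simp
    have hK2 : ∀ i ∈ R, (K i).card ≤ 2 := by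
      intro i _
      by_cases h : n i = 2 ∧ (E i).card = 3
      · rw [hKX i h.1 (hs i h.1 h.2)]; simp
      · exact hKw i h
    have hsub : Q ⊆ R.biUnion K := by
      intro U hU
      obtain ⟨i, hi⟩ := hcovQ U hU
      refine Finset.mem_biUnion.2 ⟨i, ?_, hi⟩
      have q0 : i ≠ i0 := fun h => by
        rw [h, hKX i0 hi0 rfl] at hi; simp at hi
      have q1 : i ≠ i1 := fun h => by
        rw [h, hKXc i1 hi1 hE1] at hi; simp at hi
      simp [hR, q0, q1]
    have a1 := Finset.card_le_card hsub
    have a3 := Finset.card_biUnion_le_card_mul _ _ _ hK2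
    omega

theorem sixthree_nat (y : Fin 6 → ℝ) (h0 : ∀ a, 0 < y a) (hy1 : ∀ a, y a < 1)
    (hs : ∑ a, y a = 3)
    (E : Fin 5 → Finset (Fin 6)) (n : Fin 5 → ℕ) (hn : ∀ i, n i = 1 ∨ n i = 2)
    (hm : ∀ i, (n i : ℝ) ≤ ∑ a ∈ E i, y a) :
    ∃ U ∈ T3, ∀ i, n i ≤ (U ∩ E i).card := by
  by_contra hcon
  push Not at hcon
  -- a set of mass at least `t ≥ 1` has more than `t` elements
  have big : ∀ (S : Finset (Fin 6)) (t : ℕ), 1 ≤ t → (t : ℝ) ≤ ∑ a ∈ S, y a → t < S.card := by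
    intro S t ht hS
    have hne : S.Nonempty := by
      rw [Finset.nonempty_iff_ne_empty]
      rintro rfl
      have : (1 : ℝ) ≤ t := by exact_mod_cast ht
      simp at hS
      omega
    have : ∑ a ∈ S, y a < ∑ a ∈ S, (1 : ℝ) :=
      Finset.sum_lt_sum_of_nonempty hne (fun a _ => hy1 a)
    simp at this
    have : (t : ℝ) < S.card := by linarith
    exact_mod_cast this
  have h1 : ∀ i, n i = 1 → 2 ≤ (E i).card := fun i h => big _ 1 le_rfl (by simpa [h] using hm i)
  have h2 : ∀ i, n i = 2 → 3 ≤ (E i).card := fun i h => big _ 2 (by norm_num) (by simpa [h] using hm i)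
  by_cases hst : ∃ i, n i = 2 ∧ (E i).card = 3
  · obtain ⟨i0, hi0, hX⟩ := hst
    refine caseB E n hn h1 h2 ?_ ?_ i0 hi0 hX hcon
    · intro i j hi _ hj
      apply big _ 1 le_rfl
      have a1 := Finset.sum_union_inter (s₁ := E i) (s₂ := E j) (f := y)
      have a2 : ∑ a ∈ E i ∪ E j, y a ≤ ∑ a, y a :=
        Finset.sum_le_sum_of_subset_of_nonneg (Finset.subset_univ _) (fun a _ _ => (h0 a).le)
      have a3 := hm i
      have a4 := hm j
      rw [hi] at a3
      rw [hj] at a4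
      push_cast at *
      linarith
    · intro i j hi _ hj hd
      have hsub : E j ⊆ (E i)ᶜ := by
        intro a ha
        rw [Finset.mem_compl]
        intro ha'
        have : a ∈ E j ∩ E i := Finset.mem_inter.2 ⟨ha, ha'⟩
        rw [hd] at this
        simp at this
      by_contra hne
      have hss : E j ⊂ (E i)ᶜ := lt_of_le_of_ne hsub hne
      obtain ⟨a, ha, ha'⟩ := Finset.exists_of_ssubset hss
      have a0 : ∑ b ∈ E j, y b < ∑ b ∈ (E i)ᶜ, y b :=
        Finset.sum_lt_sum_of_subset hsub ha ha' (h0 a) (fun b _ _ => (h0 b).le)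
      have a1 := Finset.sum_add_sum_compl (E i) y
      have a3 := hm i
      have a4 := hm j
      rw [hi] at a3
      rw [hj] at a4
      push_cast at *
      linarith
  · push Not at hst
    refine caseA E n hn h1 ?_ hcon
    intro i hi
    have := h2 i hi
    have := hst i hi
    omega

theorem Rnd.sixthree : Rnd (Fin 6) 3 := by
  intro y D m h0 h1 hs hm
  push_cast at hs
  obtain ⟨U, hU, hUi⟩ := sixthree_nat y h0 h1 hs
    (fun i => if m i = 1 ∨ m i = 2 then D i else Finset.univ)
    (fun i => if m i = 2 then 2 else 1)
    (by intro i; by_cases h : m i = 2 <;> simp [h])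
    (by
      intro i
      have hmi := hm i
      by_cases h : m i = 2
      · simp only [h, or_true, if_true]
        rw [h] at hmi
        push_cast at *
        exact hmi
      · by_cases h' : m i = 1
        · rw [h'] at hmi
          simp [h']
          simpa using hmi
        · simp [h, h', hs])
  rw [mem_T3] at hU
  refine ⟨U, hU, fun i => ?_⟩
  have hmi := hm i
  have hu := hUi i
  by_cases h : m i = 2
  · simp only [h, or_true, if_true] at hu
    rw [h]
    exact_mod_cast hu
  by_cases h' : m i = 1
  · simp [h'] at hu
    rw [h']
    have := Finset.card_pos.2 hu
    exact_mod_cast this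
  have hle : (∑ a ∈ D i, y a) ≤ ∑ a, y a :=
    Finset.sum_le_sum_of_subset_of_nonneg (Finset.subset_univ _) (fun a _ _ => (h0 a).le)
  have h3 : (m i : ℝ) ≤ 3 := by linarith
  have h3' : m i ≤ 3 := by exact_mod_cast h3
  by_cases h3e : m i = 3
  · have hall : D i = Finset.univ := by
      by_contra hne
      obtain ⟨a, ha⟩ : ∃ a, a ∉ D i := by
        by_contra hc
        push Not at hc
        exact hne (Finset.eq_univ_iff_forall.2 hc)
      have : ∑ b ∈ D i, y b < ∑ b, y b :=
        Finset.sum_lt_sum_of_subset (Finset.subset_univ _) (Finset.mem_univ a) ha (h0 a)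
          (fun b _ _ => (h0 b).le)
      rw [h3e] at hmi
      push_cast at hmi
      linarith
    rw [hall, Finset.inter_univ, hU, h3e]
    norm_num
  · have : (0 : ℤ) ≤ ((U ∩ D i).card : ℤ) := by positivity
    omega

end sixthree

theorem Rnd.small (α : Type*) [Fintype α] [DecidableEq α] (hα : Fintype.card α ≤ 6) (k : ℕ)
    (hk : k ≤ Fintype.card α) : Rnd α k := by
  obtain ⟨l, hl⟩ := Nat.exists_eq_add_of_le hk
  rcases Nat.lt_or_ge k 3 with h | h
  · interval_cases k
    · exact Rnd.zero α
    · exact Rnd.one α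
    · exact Rnd.two α
  rcases Nat.lt_or_ge l 3 with h' | h'
  · apply Rnd.dual α k l hl.symm
    interval_cases l
    · exact Rnd.zero α
    · exact Rnd.one α
    · exact Rnd.two α
  have hk3 : k = 3 := by omega
  have h6 : Fintype.card α = 6 := by omega
  subst hk3
  exact Rnd.congr (Fintype.equivFinOfCardEq h6) 3 Rnd.sixthree

/-- Fractional feasibility. -/
def Feas {C : Type*} [Fintype C] (D : Fin 5 → Finset C) (m : Fin 5 → ℤ) (k : ℕ) (y : C → ℝ) : Prop :=
  (∀ c, 0 ≤ y c) ∧ (∀ c, y c ≤ 1) ∧ (∑ c, y c = k) ∧ ∀ i, (m i : ℝ) ≤ ∑ c ∈ D i, y c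

open Classical in
theorem reduce_step {C : Type*} [Fintype C] (D : Fin 5 → Finset C) (m : Fin 5 → ℤ) (k : ℕ)
    (y : C → ℝ) (hy : Feas D m k y)
    (h7 : 6 < (Finset.univ.filter (fun c => 0 < y c ∧ y c < 1)).card) :
    ∃ z, Feas D m k z ∧ (Finset.univ.filter (fun c => 0 < z c ∧ z c < 1)).card <
      (Finset.univ.filter (fun c => 0 < y c ∧ y c < 1)).card := by
  obtain ⟨h0, h1, hs, hm⟩ := hy
  set F := Finset.univ.filter (fun c => 0 < y c ∧ y c < 1) with hF
  -- direction
  obtain ⟨d, hd0, hdF, hds, hdD⟩ : ∃ d : C → ℝ, d ≠ 0 ∧ (∀ c, c ∉ F → d c = 0) ∧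
      ∑ c, d c = 0 ∧ ∀ i, ∑ c ∈ D i, d c = 0 := by
    let ext : (F → ℝ) →ₗ[ℝ] (C → ℝ) :=
      { toFun := fun v c => if h : c ∈ F then v ⟨c, h⟩ else 0
        map_add' := by
          intro v w; ext c; by_cases h : c ∈ F <;> simp [h]
        map_smul' := by
          intro r v; ext c; by_cases h : c ∈ F <;> simp [h] }
    let g : (C → ℝ) →ₗ[ℝ] (Option (Fin 5) → ℝ) :=
      { toFun := fun v o => match o with
          | none => ∑ c, v c
          | some i => ∑ c ∈ D i, v c
        map_add' := by
          intro v w; ext o; cases o <;> simp [Finset.sum_add_distrib]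
        map_smul' := by
          intro r v; ext o; cases o <;> simp [Finset.mul_sum] }
    have hker : LinearMap.ker (g ∘ₗ ext) ≠ ⊥ := by
      apply LinearMap.ker_ne_bot_of_finrank_lt
      simp
      exact h7
    obtain ⟨v, hv, hv0⟩ := (Submodule.ne_bot_iff _).1 hker
    rw [LinearMap.mem_ker] at hv
    refine ⟨ext v, ?_, ?_, ?_, ?_⟩
    · intro h
      apply hv0
      ext ⟨c, hc⟩
      have := congrFun h c
      simpa [ext, hc] using this
    · intro c hc
      simp [ext, hc]
    · exact congrFun hv none
    · intro i
      exact congrFun hv (some i)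
  -- step length
  set τ : C → ℝ := fun c => if 0 < d c then (1 - y c) / d c else - y c / d c with hτ
  set G := Finset.univ.filter (fun c => d c ≠ 0) with hG
  have hGne : G.Nonempty := by
    by_contra h
    rw [Finset.not_nonempty_iff_eq_empty] at h
    apply hd0
    ext c
    by_contra hc
    have : c ∈ G := by simpa [hG] using hc
    rw [h] at this
    simp at this
  have hGF : ∀ c ∈ G, c ∈ F := by
    intro c hc
    by_contra h
    simp [hG] at hc
    exact hc (hdF c h)
  obtain ⟨c0, hc0, hmin⟩ := Finset.exists_min_image G τ hGne
  have hτpos : ∀ c ∈ G, 0 < τ c := by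
    intro c hc
    have hf := hGF c hc
    simp only [hF, Finset.mem_filter, Finset.mem_univ, true_and] at hf
    simp only [hG, Finset.mem_filter, Finset.mem_univ, true_and] at hc
    simp only [hτ]
    split_ifs with h
    · apply div_pos _ h; linarith
    · have : d c < 0 := lt_of_le_of_ne (not_lt.1 h) hc
      apply div_pos_of_neg_of_neg _ this
      linarith
  have ht := hτpos c0 hc0
  have hrange : ∀ c, 0 ≤ y c + τ c0 * d c ∧ y c + τ c0 * d c ≤ 1 := by
    intro c
    by_cases hc : c ∈ G
    · have hle := hmin c hc
      simp only [hG, Finset.mem_filter, Finset.mem_univ, true_and] at hc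
      by_cases h : 0 < d c
      · have e : τ c = (1 - y c) / d c := by simp [hτ, h]
        rw [e, le_div_iff₀ h] at hle
        have := mul_pos ht h
        constructor <;> linarith [h0 c]
      · have hn : d c < 0 := lt_of_le_of_ne (not_lt.1 h) hc
        have e : τ c = - y c / d c := by simp [hτ, h]
        rw [e, le_div_iff_of_neg hn] at hle
        have := mul_neg_of_pos_of_neg ht hn
        constructor <;> linarith [h1 c]
    · have : d c = 0 := by simpa [hG] using hc
      rw [this]
      simp [h0 c, h1 c]
  refine ⟨fun c => y c + τ c0 * d c, ⟨fun c => (hrange c).1, fun c => (hrange c).2, ?_, ?_⟩, ?_⟩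
  · rw [Finset.sum_add_distrib, ← Finset.mul_sum, hds, hs]; simp
  · intro i
    rw [Finset.sum_add_distrib, ← Finset.mul_sum, hdD i]
    simpa using hm i
  · apply Finset.card_lt_card
    rw [Finset.ssubset_iff_of_subset]
    · refine ⟨c0, hGF c0 hc0, ?_⟩
      simp only [hG, Finset.mem_filter, Finset.mem_univ, true_and] at hc0
      simp only [Finset.mem_filter, Finset.mem_univ, true_and]
      by_cases h : 0 < d c0
      · have e : τ c0 = (1 - y c0) / d c0 := by simp [hτ, h]
        rw [e, div_mul_cancel₀ _ hc0]
        simp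
      · have e : τ c0 = - y c0 / d c0 := by simp [hτ, h]
        rw [e, div_mul_cancel₀ _ hc0]
        simp
    · intro c hc
      by_contra hcF
      have hz := hdF c hcF
      simp [hz] at hc
      exact hcF (by simpa [hF] using hc)

open Classical in
theorem reduce {C : Type*} [Fintype C] (D : Fin 5 → Finset C) (m : Fin 5 → ℤ) (k : ℕ)
    (N : ℕ) : ∀ (y : C → ℝ), Feas D m k y →
    (Finset.univ.filter (fun c => 0 < y c ∧ y c < 1)).card ≤ N →
    ∃ z, Feas D m k z ∧ (Finset.univ.filter (fun c => 0 < z c ∧ z c < 1)).card ≤ 6 := by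
  induction N with
  | zero => intro y hy h; exact ⟨y, hy, by omega⟩
  | succ N ih =>
    intro y hy h
    by_cases h6 : (Finset.univ.filter (fun c => 0 < y c ∧ y c < 1)).card ≤ 6
    · exact ⟨y, hy, h6⟩
    · obtain ⟨z, hz, hlt⟩ := reduce_step D m k y hy (by omega)
      exact ih z hz (by omega)

open Classical in
theorem rounding_eq {C : Type*} [Fintype C] (D : Fin 5 → Finset C) (m : Fin 5 → ℤ) (k : ℕ)
    (y : C → ℝ) (hy : Feas D m k y) :
    ∃ W : Finset C, W.card ≤ k ∧ ∀ i, m i ≤ ((W ∩ D i).card : ℤ) := by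
  obtain ⟨z, ⟨h0, h1, hs, hm⟩, h6⟩ := reduce D m k _ y hy le_rfl
  set F := Finset.univ.filter (fun c => 0 < z c ∧ z c < 1) with hF
  set W1 := Finset.univ.filter (fun c => z c = 1) with hW1
  have hdisj : Disjoint F W1 := by
    rw [Finset.disjoint_left]
    intro c hc hc'
    simp [hF] at hc
    simp [hW1] at hc'
    linarith [hc.2]
  have hsplit : ∀ S : Finset C, ∑ c ∈ S, z c = ∑ c ∈ S ∩ F, z c + ((S ∩ W1).card : ℝ) := by
    intro S
    have e1 : ((S ∩ W1).card : ℝ) = ∑ c ∈ S ∩ W1, z c := by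
      rw [Finset.card_eq_sum_ones]
      push_cast
      apply Finset.sum_congr rfl
      intro c hc
      simp [hW1] at hc
      exact hc.2.symm
    rw [e1, ← Finset.sum_union (hdisj.mono Finset.inter_subset_right Finset.inter_subset_right)]
    symm
    apply Finset.sum_subset
    · intro c hc
      simp only [Finset.mem_union, Finset.mem_inter] at hc
      tauto
    · intro c hc hn
      simp only [Finset.mem_union, Finset.mem_inter, hc, true_and, hF, hW1, Finset.mem_filter,
        Finset.mem_univ, not_or, not_and] at hn
      by_contra hne
      have hp : 0 < z c := lt_of_le_of_ne (h0 c) (Ne.symm hne)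
      exact hn.2 (le_antisymm (h1 c) (not_lt.1 (hn.1 hp)))
  have hsF := hsplit Finset.univ
  rw [Finset.univ_inter, Finset.univ_inter, hs] at hsF
  have hnn : 0 ≤ ∑ c ∈ F, z c := Finset.sum_nonneg (fun c _ => h0 c)
  have hkW : W1.card ≤ k := by
    have : (W1.card : ℝ) ≤ k := by linarith
    exact_mod_cast this
  obtain ⟨k1, hk1⟩ := Nat.exists_eq_add_of_le hkW
  have hk1r : (k : ℝ) = W1.card + k1 := by exact_mod_cast hk1
  have hFk : ∑ c ∈ F, z c = k1 := by linarith
  have hk1F : k1 ≤ F.card := by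
    have : ∑ c ∈ F, z c ≤ ∑ c ∈ F, (1 : ℝ) := Finset.sum_le_sum (fun c _ => h1 c)
    rw [hFk] at this
    simp at this
    exact this
  have hR : Rnd F k1 := Rnd.small F (by simpa using h6) k1 (by simpa using hk1F)
  obtain ⟨U, hU, hUi⟩ := hR (fun a => z a.1) (fun i => Finset.univ.filter (fun a => a.1 ∈ D i))
    (fun i => m i - ((D i ∩ W1).card : ℤ))
    (fun a => by have := a.2; simp only [hF, Finset.mem_filter] at this; exact this.2.1)
    (fun a => by have := a.2; simp only [hF, Finset.mem_filter] at this; exact this.2.2)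
    (by rw [← hFk]; exact Finset.sum_coe_sort F z)
    (by
      intro i
      have h2 := hm i
      rw [hsplit (D i)] at h2
      have : ∑ a ∈ Finset.univ.filter (fun a : F => a.1 ∈ D i), z a.1 = ∑ c ∈ D i ∩ F, z c := by
        rw [Finset.sum_filter, Finset.inter_comm, ← Finset.filter_mem_eq_inter, Finset.sum_filter]
        exact Finset.sum_coe_sort F (fun c => if c ∈ D i then z c else 0)
      rw [this]
      push_cast
      linarith)
  set U' : Finset C := U.map (Function.Embedding.subtype _) with hU'
  have hU'F : U' ⊆ F := by
    intro c hc
    simp only [hU', Finset.mem_map] at hc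
    obtain ⟨a, _, rfl⟩ := hc
    exact a.2
  have hd2 : Disjoint U' W1 := hdisj.mono_left hU'F
  refine ⟨U' ∪ W1, ?_, fun i => ?_⟩
  · rw [Finset.card_union_of_disjoint hd2, hU', Finset.card_map, hU]
    omega
  · have h3 := hUi i
    have e : (U ∩ Finset.univ.filter (fun a : F => a.1 ∈ D i)).card = (U' ∩ D i).card := by
      rw [← Finset.card_map (Function.Embedding.subtype _)]
      congr 1
      ext c
      simp only [hU', Finset.mem_map, Finset.mem_inter, Finset.mem_filter, Finset.mem_univ, true_and,
        Function.Embedding.subtype_apply]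
      constructor
      · rintro ⟨a, ⟨ha, hb⟩, rfl⟩
        exact ⟨⟨a, ha, rfl⟩, hb⟩
      · rintro ⟨⟨a, ha, rfl⟩, hb⟩
        exact ⟨a, ⟨ha, hb⟩, rfl⟩
    rw [e] at h3
    have e2 : ((U' ∪ W1) ∩ D i).card = (U' ∩ D i).card + (D i ∩ W1).card := by
      rw [Finset.union_inter_distrib_right, Finset.card_union_of_disjoint, Finset.inter_comm W1]
      exact hd2.mono Finset.inter_subset_left Finset.inter_subset_left
    rw [e2]
    push_cast
    linarith

open Classical in
theorem rounding {C : Type*} [Fintype C] (D : Fin 5 → Finset C) (m : Fin 5 → ℤ) (k : ℕ)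
    (y : C → ℝ) (h0 : ∀ c, 0 ≤ y c) (h1 : ∀ c, y c ≤ 1) (hs : ∑ c, y c ≤ k)
    (hm : ∀ i, (m i : ℝ) ≤ ∑ c ∈ D i, y c) :
    ∃ W : Finset C, W.card ≤ k ∧ ∀ i, m i ≤ ((W ∩ D i).card : ℤ) := by
  rcases Nat.lt_or_ge k (Fintype.card C) with h | h
  · set s := ∑ c, y c with hsdef
    have hN : (k : ℝ) < Fintype.card C := by exact_mod_cast h
    have hpos : 0 < (Fintype.card C : ℝ) - s := by linarith
    set t := ((k : ℝ) - s) / (Fintype.card C - s) with ht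
    have ht0 : 0 ≤ t := div_nonneg (by linarith) hpos.le
    have ht1 : t ≤ 1 := (div_le_one hpos).2 (by linarith)
    have hge : ∀ c, y c ≤ y c + t * (1 - y c) := by
      intro c
      have := mul_nonneg ht0 (sub_nonneg.2 (h1 c))
      linarith
    apply rounding_eq D m k (fun c => y c + t * (1 - y c))
    refine ⟨fun c => (h0 c).trans (hge c), fun c => ?_, ?_, fun i => ?_⟩
    · nlinarith [h1 c]
    · rw [Finset.sum_add_distrib, ← Finset.mul_sum, Finset.sum_sub_distrib, ← hsdef]
      simp only [Finset.sum_const, Finset.card_univ, nsmul_eq_mul, mul_one]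
      rw [ht, div_mul_cancel₀ _ hpos.ne']
      ring
    · exact (hm i).trans (Finset.sum_le_sum (fun c _ => hge c))
  · refine ⟨Finset.univ, by simpa using h, fun i => ?_⟩
    have h2 : ∑ c ∈ D i, y c ≤ ∑ c ∈ D i, (1 : ℝ) := Finset.sum_le_sum (fun c _ => h1 c)
    have h3 : (m i : ℝ) ≤ ((D i).card : ℝ) := by
      have := hm i
      simp at h2
      linarith
    rw [Finset.univ_inter]
    exact_mod_cast h3

section Scarf

/-- Scarf domination of a set of columns with respect to the rank functions `r`. -/
def SDom {I J : Type*} (r : I → J → ℕ) (D : Finset J) : Prop :=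
  ∀ j, ∃ i, ∀ d ∈ D, r i j ≤ r i d

theorem SDom.mono {I J : Type*} {r : I → J → ℕ} {D D' : Finset J} (h : SDom r D) (hs : D' ⊆ D) :
    SDom r D' := by
  intro j
  obtain ⟨i, hi⟩ := h j
  exact ⟨i, fun d hd => hi d (hs hd)⟩

/-- Columns that are dominated at most at row `i`. -/
def MSet {I J : Type*} (r : I → J → ℕ) (mn : I → J) (i : I) (j : J) : Prop :=
  ∀ i', i' ≠ i → r i' (mn i') < r i' j

/-- The maximal such column. -/
def MMax {I J : Type*} (r : I → J → ℕ) (mn : I → J) (i : I) (j : J) : Prop :=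
  MSet r mn i j ∧ ∀ j', MSet r mn i j' → r i j' ≤ r i j

open Classical in
theorem mmax_card_one {I J : Type*} [Fintype J] (r : I → J → ℕ)
    (hr : ∀ i, Function.Injective (r i)) (mn : I → J) (i : I) (h : ∃ j, MSet r mn i j) :
    (Finset.univ.filter (fun j => MMax r mn i j)).card = 1 := by
  obtain ⟨j0, hj0⟩ := h
  obtain ⟨j, hj, hmax⟩ := Finset.exists_max_image (Finset.univ.filter (fun j => MSet r mn i j)) (r i)
    ⟨j0, by simpa using hj0⟩
  simp only [Finset.mem_filter, Finset.mem_univ, true_and] at hj hmax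
  rw [Finset.card_eq_one]
  refine ⟨j, ?_⟩
  ext j'
  simp only [Finset.mem_filter, Finset.mem_univ, true_and, Finset.mem_singleton]
  constructor
  · rintro ⟨h1, h2⟩
    exact hr i (le_antisymm (hmax j' h1) (h2 j hj))
  · rintro rfl
    exact ⟨hj, hmax⟩

open Classical in
theorem mmax_card_zero {I J : Type*} [Fintype J] (r : I → J → ℕ)
    (mn : I → J) (i : I) (h : ¬ ∃ j, MSet r mn i j) :
    (Finset.univ.filter (fun j => MMax r mn i j)).card = 0 := by
  rw [Finset.card_eq_zero, Finset.filter_eq_empty_iff]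
  intro j _ hj
  exact h ⟨j, hj.1⟩

open Classical in
theorem ord_structure {I J : Type*} [Fintype I] [Fintype J] (r : I → J → ℕ)
    (hr : ∀ i, Function.Injective (r i)) (K : Finset J) (hK : K.card + 1 = Fintype.card I)
    (mn : I → J) (hmnK : ∀ i, mn i ∈ K) (hmn : ∀ i, ∀ d ∈ K, r i (mn i) ≤ r i d)
    (hdom : SDom r K) :
    ∃ i1 i2, i1 ≠ i2 ∧ mn i1 = mn i2 ∧
      (Finset.univ.filter (fun j => j ∉ K ∧ SDom r (insert j K))).card =
        (Finset.univ.filter (fun j => MMax r mn i1 j)).card +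
        (Finset.univ.filter (fun j => MMax r mn i2 j)).card := by
  have hargmin : ∀ i k, k ∈ K → (∀ d ∈ K, r i k ≤ r i d) → mn i = k := by
    intro i k hk h
    exact hr i (le_antisymm (hmn i k hk) (h _ (hmnK i)))
  have hsurj : ∀ k ∈ K, ∃ i, mn i = k := by
    intro k hk
    obtain ⟨i, hi⟩ := hdom k
    exact ⟨i, hargmin i k hk hi⟩
  -- surjective on the complement of one index implies injective there
  have hinj : ∀ i0, (∀ k ∈ K, ∃ i, i ≠ i0 ∧ mn i = k) →
      ∀ i i', i ≠ i0 → i' ≠ i0 → mn i = mn i' → i = i' := by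
    intro i0 hs i i' hi hi' he
    have h1 : Set.InjOn mn ((Finset.univ.erase i0 : Finset I) : Set I) := by
      apply Finset.injOn_of_surjOn_of_card_le mn (t := K)
      · intro i _; exact hmnK i
      · intro k hk
        obtain ⟨i, hi, he⟩ := hs k hk
        exact ⟨i, by simpa using hi, he⟩
      · rw [Finset.card_erase_of_mem (Finset.mem_univ _), Finset.card_univ]
        omega
    exact h1 (by simpa using hi) (by simpa using hi') he
  obtain ⟨i1, -, i2, -, h12, he12⟩ := Finset.exists_ne_map_eq_of_card_lt_of_maps_to
    (s := (Finset.univ : Finset I)) (t := K) (f := mn)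
    (by rw [Finset.card_univ]; omega) (fun i _ => hmnK i)
  have hs1 : ∀ k ∈ K, ∃ i, i ≠ i1 ∧ mn i = k := by
    intro k hk
    obtain ⟨i, hi⟩ := hsurj k hk
    by_cases h : i = i1
    · exact ⟨i2, h12.symm, by rw [← he12, ← h, hi]⟩
    · exact ⟨i, h, hi⟩
  have hs2 : ∀ k ∈ K, ∃ i, i ≠ i2 ∧ mn i = k := by
    intro k hk
    obtain ⟨i, hi⟩ := hsurj k hk
    by_cases h : i = i2
    · exact ⟨i1, h12, by rw [he12, ← h, hi]⟩
    · exact ⟨i, h, hi⟩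
  refine ⟨i1, i2, h12, he12, ?_⟩
  have hback : ∀ i0, (∀ k ∈ K, ∃ i, i ≠ i0 ∧ mn i = k) → ∀ j, MMax r mn i0 j →
      j ∉ K ∧ SDom r (insert j K) := by
    intro i0 hs j hj
    constructor
    · intro hjK
      obtain ⟨i, hi, he⟩ := hs j hjK
      have := hj.1 i hi
      rw [he] at this
      exact lt_irrefl _ this
    · intro j'
      by_cases hM : MSet r mn i0 j'
      · obtain ⟨i, hi⟩ := hdom j'
        have hii : i = i0 := by
          by_contra hne
          have h1 := hM i hne
          have h2 := hi _ (hmnK i)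
          omega
        subst hii
        refine ⟨i, fun d hd => ?_⟩
        rcases Finset.mem_insert.1 hd with rfl | hd
        · exact hj.2 j' hM
        · exact hi d hd
      · simp only [MSet, not_forall, not_lt] at hM
        obtain ⟨i, hi, hle⟩ := hM
        refine ⟨i, fun d hd => ?_⟩
        rcases Finset.mem_insert.1 hd with rfl | hd
        · exact hle.trans (hj.1 i hi).le
        · exact hle.trans (hmn i d hd)
  have hset : Finset.univ.filter (fun j => j ∉ K ∧ SDom r (insert j K)) =
      Finset.univ.filter (fun j => MMax r mn i1 j) ∪
      Finset.univ.filter (fun j => MMax r mn i2 j) := by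
    ext j
    simp only [Finset.mem_filter, Finset.mem_univ, true_and, Finset.mem_union]
    constructor
    · rintro ⟨hjK, hD⟩
      obtain ⟨i0, hi0⟩ := hD j
      have hs0 : ∀ k ∈ K, ∃ i, (i ≠ i0 ∧ mn i = k) ∧ r i k ≤ r i j := by
        intro k hk
        obtain ⟨i, hi⟩ := hD k
        have hkj := hi j (Finset.mem_insert_self _ _)
        refine ⟨i, ⟨?_, hargmin i k hk (fun d hd => hi d (Finset.mem_insert_of_mem hd))⟩, hkj⟩
        rintro rfl
        have h2 := hi0 k (Finset.mem_insert_of_mem hk)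
        have : j = k := hr i (le_antisymm h2 hkj)
        exact hjK (this ▸ hk)
      have hin := hinj i0 (fun k hk => by
        obtain ⟨i, hi, _⟩ := hs0 k hk
        exact ⟨i, hi⟩)
      have hmax : MMax r mn i0 j := by
        constructor
        · intro i hi
          obtain ⟨i', ⟨hi', he⟩, hle⟩ := hs0 (mn i) (hmnK i)
          have := hin i' i hi' hi he
          subst this
          apply lt_of_le_of_ne hle
          intro h
          exact hjK (hr _ h ▸ hmnK i')
        · intro j' hj'
          obtain ⟨i, hi⟩ := hD j'
          have hii : i = i0 := by
            by_contra hne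
            have h1 := hj' i hne
            have h2 := hi _ (Finset.mem_insert_of_mem (hmnK i))
            omega
          subst hii
          exact hi j (Finset.mem_insert_self _ _)
      by_cases h1 : i0 = i1
      · left; rw [← h1]; exact hmax
      by_cases h2 : i0 = i2
      · right; rw [← h2]; exact hmax
      exact absurd (hin i1 i2 (Ne.symm h1) (Ne.symm h2) he12) h12
    · rintro (h | h)
      · exact hback i1 hs1 j h
      · exact hback i2 hs2 j h
  rw [hset, Finset.card_union_of_disjoint]
  rw [Finset.disjoint_left]
  intro j hj hj'
  simp only [Finset.mem_filter, Finset.mem_univ, true_and] at hj hj'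
  obtain ⟨i, hi⟩ := hdom j
  have h3 := hi _ (hmnK i)
  by_cases h1 : i = i1
  · have := hj'.1 i (by rw [h1]; exact h12)
    omega
  · have := hj.1 i h1
    omega

theorem exists_mn {I J : Type*} (r : I → J → ℕ) (K : Finset J) (hne : K.Nonempty) :
    ∃ mn : I → J, (∀ i, mn i ∈ K) ∧ ∀ i, ∀ d ∈ K, r i (mn i) ≤ r i d := by
  have : ∀ i, ∃ k, k ∈ K ∧ ∀ d ∈ K, r i k ≤ r i d := by
    intro i
    obtain ⟨k, hk, h⟩ := Finset.exists_min_image K (r i) hne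
    exact ⟨k, hk, h⟩
  choose mn h using this
  exact ⟨mn, fun i => (h i).1, fun i => (h i).2⟩

open Classical in
theorem ord_even {I J : Type*} [Fintype I] [Fintype J] (r : I → J → ℕ)
    (hr : ∀ i, Function.Injective (r i)) (e : I → J)
    (he2 : ∀ i k j, k ≠ i → (∀ l, j ≠ e l) → r i j < r i (e k))
    (K : Finset J) (hK : K.card + 1 = Fintype.card I)
    (k0 : J) (hk0 : k0 ∈ K) (hk0e : ∀ l, k0 ≠ e l) :
    Even (Finset.univ.filter (fun j => j ∉ K ∧ SDom r (insert j K))).card := by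
  by_cases hdom : SDom r K
  · obtain ⟨mn, hmnK, hmn⟩ := exists_mn r K ⟨k0, hk0⟩
    obtain ⟨i1, i2, _, _, hc⟩ := ord_structure r hr K hK mn hmnK hmn hdom
    have hM : ∀ i, ∃ j, MSet r mn i j := by
      intro i
      refine ⟨e i, fun i' hi' => ?_⟩
      exact (hmn i' k0 hk0).trans_lt (he2 i' i k0 hi'.symm hk0e)
    rw [hc, mmax_card_one r hr mn i1 (hM i1), mmax_card_one r hr mn i2 (hM i2)]
    decide
  · have : Finset.univ.filter (fun j => j ∉ K ∧ SDom r (insert j K)) = ∅ := by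
      rw [Finset.filter_eq_empty_iff]
      rintro j _ ⟨_, h⟩
      exact hdom (h.mono (Finset.subset_insert _ _))
    rw [this]
    simp

open Classical in
theorem ord_odd {I J : Type*} [Fintype I] [Fintype J] (r : I → J → ℕ)
    (hr : ∀ i, Function.Injective (r i)) (e : I → J) (hinj : Function.Injective e)
    (he1 : ∀ i j, j ≠ e i → r i (e i) < r i j)
    (he2 : ∀ i k j, k ≠ i → (∀ l, j ≠ e l) → r i j < r i (e k))
    (hI : 2 ≤ Fintype.card I) (o : I) :
    Odd (Finset.univ.filter (fun j => j ∉ (Finset.univ.image e).erase (e o) ∧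
      SDom r (insert j ((Finset.univ.image e).erase (e o))))).card := by
  set K := (Finset.univ.image e).erase (e o) with hKdef
  have hmem : ∀ j, j ∈ K ↔ ∃ i, i ≠ o ∧ e i = j := by
    intro j
    simp only [hKdef, Finset.mem_erase, Finset.mem_image, Finset.mem_univ, true_and]
    constructor
    · rintro ⟨h, i, rfl⟩
      exact ⟨i, fun h' => h (by rw [h']), rfl⟩
    · rintro ⟨i, h, rfl⟩
      exact ⟨fun h' => h (hinj h'), i, rfl⟩
  have hK : K.card + 1 = Fintype.card I := by
    rw [hKdef, Finset.card_erase_of_mem (by simp), Finset.card_image_of_injective _ hinj,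
      Finset.card_univ]
    omega
  have hdom : SDom r K := by
    intro j
    by_cases hj : ∃ i, j = e i
    · obtain ⟨i, rfl⟩ := hj
      refine ⟨i, fun d _ => ?_⟩
      by_cases h : d = e i
      · rw [h]
      · exact (he1 i d h).le
    · push Not at hj
      refine ⟨o, fun d hd => ?_⟩
      obtain ⟨i, hi, rfl⟩ := (hmem d).1 hd
      exact (he2 o i j hi hj).le
  obtain ⟨mn, hmnK, hmn⟩ := exists_mn r K (Finset.card_pos.1 (by omega))
  have hmne : ∀ i, i ≠ o → mn i = e i := by
    intro i hi
    by_contra h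
    have h1 := he1 i _ h
    have h2 := hmn i (e i) ((hmem _).2 ⟨i, hi, rfl⟩)
    omega
  obtain ⟨i1, i2, h12, he12, hc⟩ := ord_structure r hr K hK mn hmnK hmn hdom
  have hMo : ∃ j, MSet r mn o j := by
    refine ⟨e o, fun i hi => ?_⟩
    rw [hmne i hi]
    exact he1 i _ (fun h => hi (hinj h).symm)
  have hMb : ∀ b, b ≠ o → mn b = mn o → ¬ ∃ j, MSet r mn b j := by
    rintro b hb hbo ⟨j, hj⟩
    rw [hmne b hb] at hbo
    have h1 := hj o hb.symm
    rw [← hbo] at h1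
    by_cases hje : ∃ l, j = e l
    · obtain ⟨l, rfl⟩ := hje
      by_cases hlo : l = o
      · subst hlo
        have := he1 l (e b) (fun h => hb (hinj h))
        omega
      by_cases hlb : l = b
      · subst hlb; omega
      have := hj l hlb
      rw [hmne l hlo] at this
      omega
    · push Not at hje
      have := he2 o b j hb hje
      omega
  rw [hc]
  by_cases h1 : i1 = o
  · subst h1
    rw [mmax_card_one r hr mn i1 hMo, mmax_card_zero r mn i2 (hMb i2 h12.symm he12.symm)]
    decide
  by_cases h2 : i2 = o
  · subst h2
    rw [mmax_card_one r hr mn i2 hMo, mmax_card_zero r mn i1 (hMb i1 h12 he12)]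
    decide
  rw [hmne i1 h1, hmne i2 h2] at he12
  exact absurd (hinj he12) h12

end Scarf

section Cardinal

/-- `x` is a nonnegative solution of `∑ x j a j = b` supported on `K`. -/
def Sol {I J : Type*} [Fintype J] (a : J → I → ℝ) (b : I → ℝ) (K : Finset J) (x : J → ℝ) : Prop :=
  (∀ j, 0 ≤ x j) ∧ (∀ j, j ∉ K → x j = 0) ∧ ∑ j, x j • a j = b

/-- `b` avoids all proper subspaces spanned by columns. -/
def Generic {I J : Type*} (a : J → I → ℝ) (b : I → ℝ) : Prop :=
  ∀ K : Finset J, b ∈ Submodule.span ℝ (a '' (K : Set J)) → Submodule.span ℝ (a '' (K : Set J)) = ⊤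

theorem Sol.supp {I J : Type*} [Fintype I] [Fintype J] [DecidableEq J] {a : J → I → ℝ} {b : I → ℝ}
    (hb : Generic a b) {K : Finset J} {x : J → ℝ} (hx : Sol a b K x) :
    Fintype.card I ≤ (K.filter (fun j => x j ≠ 0)).card := by
  classical
  set S := K.filter (fun j => x j ≠ 0) with hS
  have hbS : b ∈ Submodule.span ℝ (a '' (S : Set J)) := by
    rw [← hx.2.2]
    apply Submodule.sum_mem
    intro j _
    by_cases hj : j ∈ S
    · exact Submodule.smul_mem _ _ (Submodule.subset_span ⟨j, hj, rfl⟩)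
    · have : x j = 0 := by
        by_contra h
        apply hj
        simp only [hS, Finset.mem_filter]
        refine ⟨?_, h⟩
        by_contra hK
        exact h (hx.2.1 j hK)
      rw [this, zero_smul]
      exact Submodule.zero_mem _
  have htop := hb S hbS
  have h1 : Module.finrank ℝ (Submodule.span ℝ (a '' (S : Set J))) ≤ (S.image a).card := by
    rw [← Finset.coe_image]
    exact finrank_span_finset_le_card _
  rw [htop, finrank_top, Module.finrank_fintype_fun_eq_card] at h1
  exact h1.trans Finset.card_image_le

theorem Sol.pos {I J : Type*} [Fintype I] [Fintype J] [DecidableEq J] {a : J → I → ℝ} {b : I → ℝ}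
    (hb : Generic a b) {K : Finset J} {x : J → ℝ} (hx : Sol a b K x)
    (hK : K.card = Fintype.card I) : ∀ j ∈ K, 0 < x j := by
  intro j hj
  apply lt_of_le_of_ne (hx.1 j)
  intro h
  have h1 := hx.supp hb
  have h2 : (K.filter (fun j => x j ≠ 0)).card < K.card := by
    apply Finset.card_lt_card
    rw [Finset.ssubset_iff_of_subset (Finset.filter_subset _ _)]
    exact ⟨j, hj, by simp [h.symm]⟩
  omega

/-- Moving along a direction with a negative coordinate until a coordinate vanishes. -/
theorem Sol.move {I J : Type*} [Fintype J] [DecidableEq J] {a : J → I → ℝ} {b : I → ℝ}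
    {K : Finset J} {x : J → ℝ} (hx : Sol a b K x) (z : J → ℝ) (hz : ∑ j, z j • a j = 0)
    (hzK : ∀ j, j ∉ K → 0 ≤ z j) (hneg : ∃ j, z j < 0) (M : Finset J) (hKM : K ⊆ M)
    (hzM : ∀ j, j ∉ M → z j = 0) :
    ∃ j ∈ K, z j < 0 ∧ ∃ x', Sol a b (M.erase j) x' := by
  obtain ⟨j0, hj0⟩ := hneg
  obtain ⟨j, hj, hmin⟩ := Finset.exists_min_image (Finset.univ.filter (fun j => z j < 0))
    (fun j => x j / (- z j)) ⟨j0, by simpa using hj0⟩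
  simp only [Finset.mem_filter, Finset.mem_univ, true_and] at hj hmin
  set t := x j / (- z j) with ht
  have ht0 : 0 ≤ t := div_nonneg (hx.1 j) (by linarith)
  have hjK : j ∈ K := by
    by_contra h
    have := hzK j h
    linarith
  refine ⟨j, hjK, hj, fun l => x l + t * z l, ?_, ?_, ?_⟩
  · intro l
    by_cases hl : z l < 0
    · have := hmin l hl
      rw [le_div_iff₀ (by linarith)] at this
      linarith
    · have := mul_nonneg ht0 (not_lt.1 hl)
      have := hx.1 l
      linarith
  · intro l hl
    rw [Finset.mem_erase, not_and_or, not_not] at hl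
    rcases hl with rfl | hl
    · have : t * (- z l) = x l := by rw [ht]; exact div_mul_cancel₀ _ (by linarith)
      linarith
    · show x l + t * z l = 0
      rw [hzM l hl, hx.2.1 l (fun h => hl (hKM h))]
      simp
  · simp only [add_smul, Finset.sum_add_distrib, hx.2.2, mul_smul, ← Finset.smul_sum, hz]
    simp

theorem Sol.ker {I J : Type*} [Fintype I] [Fintype J] [DecidableEq J] {a : J → I → ℝ} {b : I → ℝ}
    (hb : Generic a b) {K : Finset J} {x : J → ℝ} (hx : Sol a b K x)
    (hK : K.card = Fintype.card I) (z : J → ℝ) (hz : ∑ j, z j • a j = 0)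
    (hzK : ∀ j, j ∉ K → z j = 0) : ∀ j, z j = 0 := by
  have main : ∀ z : J → ℝ, ∑ j, z j • a j = 0 → (∀ j, j ∉ K → z j = 0) → ¬ ∃ j, z j < 0 := by
    intro z hz hzK hneg
    obtain ⟨j, hj, _, x', hx'⟩ := hx.move z hz (fun j hj => (hzK j hj).ge) hneg K subset_rfl hzK
    have h1 := hx'.supp hb
    have h2 := Finset.card_le_card (Finset.filter_subset (fun j => x' j ≠ 0) (K.erase j))
    have h3 : (K.erase j).card < K.card := Finset.card_erase_lt_of_mem hj
    omega
  intro j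
  have h1 := main z hz hzK
  have h2 := main (fun j => - z j) (by simp [neg_smul, hz]) (fun j hj => by simp [hzK j hj])
  push Not at h1 h2
  have := h1 j
  have := h2 j
  linarith

open Classical in
theorem card_even {I J : Type*} [Fintype I] [Fintype J] {a : J → I → ℝ} {b : I → ℝ}
    (ha0 : ∀ j i, 0 ≤ a j i) (ha1 : ∀ j, ∃ i, 1 ≤ a j i)
    (hb : Generic a b) (M : Finset J) (hM : M.card = Fintype.card I + 1) :
    Even (M.filter (fun j => ∃ x, Sol a b (M.erase j) x)).card := by
  by_cases hex : ∃ j ∈ M, ∃ x, Sol a b (M.erase j) x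
  swap
  · have : M.filter (fun j => ∃ x, Sol a b (M.erase j) x) = ∅ := by
      rw [Finset.filter_eq_empty_iff]
      intro j hj h
      exact hex ⟨j, hj, h⟩
    rw [this]; simp
  obtain ⟨j1, hj1, x1, hx1⟩ := hex
  have hcard : ∀ j ∈ M, (M.erase j).card = Fintype.card I := by
    intro j hj
    rw [Finset.card_erase_of_mem hj]; omega
  -- a kernel direction
  obtain ⟨z0, hz00, hz0M, hz0⟩ : ∃ z : J → ℝ, z ≠ 0 ∧ (∀ j, j ∉ M → z j = 0) ∧
      ∑ j, z j • a j = 0 := by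
    let ext : (M → ℝ) →ₗ[ℝ] (J → ℝ) :=
      { toFun := fun v c => if h : c ∈ M then v ⟨c, h⟩ else 0
        map_add' := by
          intro v w; ext c; by_cases h : c ∈ M <;> simp [h]
        map_smul' := by
          intro r v; ext c; by_cases h : c ∈ M <;> simp [h] }
    let g : (J → ℝ) →ₗ[ℝ] (I → ℝ) :=
      { toFun := fun v => ∑ j, v j • a j
        map_add' := by
          intro v w; simp [add_smul, Finset.sum_add_distrib]
        map_smul' := by
          intro r v; simp [mul_smul, Finset.smul_sum] }
    have hker : LinearMap.ker (g ∘ₗ ext) ≠ ⊥ := by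
      apply LinearMap.ker_ne_bot_of_finrank_lt
      simp
      omega
    obtain ⟨v, hv, hv0⟩ := (Submodule.ne_bot_iff _).1 hker
    rw [LinearMap.mem_ker] at hv
    refine ⟨ext v, ?_, ?_, hv⟩
    · intro h
      apply hv0
      ext ⟨c, hc⟩
      have := congrFun h c
      simpa [ext, hc] using this
    · intro c hc
      simp [ext, hc]
  have hker1 : ∀ z : J → ℝ, ∑ j, z j • a j = 0 → (∀ j, j ∉ M → z j = 0) → z j1 = 0 →
      ∀ j, z j = 0 := by
    intro z hz hzM hzj
    apply hx1.ker hb (hcard j1 hj1) z hz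
    intro j hj
    rw [Finset.mem_erase, not_and_or, not_not] at hj
    rcases hj with rfl | hj
    · exact hzj
    · exact hzM j hj
  have hz01 : z0 j1 ≠ 0 := by
    intro h
    exact hz00 (funext (hker1 z0 hz0 hz0M h))
  obtain ⟨z, hz1, hzM, hz⟩ : ∃ z : J → ℝ, 0 < z j1 ∧ (∀ j, j ∉ M → z j = 0) ∧
      ∑ j, z j • a j = 0 := by
    rcases lt_or_gt_of_ne hz01 with h | h
    · exact ⟨fun j => - z0 j, by simpa using h, fun j hj => by simp [hz0M j hj],
        by simp [neg_smul, hz0]⟩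
    · exact ⟨z0, h, hz0M, hz0⟩
  have hneg : ∃ j, z j < 0 := by
    by_contra h
    push Not at h
    obtain ⟨i, hi⟩ := ha1 j1
    have h1 := congrFun hz i
    simp only [Finset.sum_apply, Pi.smul_apply, smul_eq_mul, Pi.zero_apply] at h1
    have h2 := (Finset.sum_eq_zero_iff_of_nonneg (fun j _ => mul_nonneg (h j) (ha0 j i))).1 h1 j1
      (Finset.mem_univ _)
    have : 0 < z j1 * a j1 i := mul_pos hz1 (by linarith)
    linarith
  obtain ⟨j2, hj2, _, x2, hx2⟩ := hx1.move z hz (by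
    intro j hj
    rw [Finset.mem_erase, not_and_or, not_not] at hj
    rcases hj with rfl | hj
    · exact hz1.le
    · exact (hzM j hj).ge) hneg M (Finset.erase_subset _ _) hzM
  rw [Finset.mem_erase] at hj2
  have hset : M.filter (fun j => ∃ x, Sol a b (M.erase j) x) = {j1, j2} := by
    ext j3
    simp only [Finset.mem_filter, Finset.mem_insert, Finset.mem_singleton]
    constructor
    · rintro ⟨hj3, x3, hx3⟩
      by_contra hne
      push Not at hne
      have p1 := hx1.pos hb (hcard j1 hj1)
      have p2 := hx2.pos hb (hcard j2 hj2.2)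
      have p3 := hx3.pos hb (hcard j3 hj3)
      have q1 : x1 j1 = 0 := hx1.2.1 j1 (by simp)
      have q2 : x2 j2 = 0 := hx2.2.1 j2 (by simp)
      have q3 : x3 j3 = 0 := hx3.2.1 j3 (by simp)
      have o1 : ∀ j, j ∉ M → x1 j = 0 := fun j hj => hx1.2.1 j (by simp [hj])
      have o2 : ∀ j, j ∉ M → x2 j = 0 := fun j hj => hx2.2.1 j (by simp [hj])
      have o3 : ∀ j, j ∉ M → x3 j = 0 := fun j hj => hx3.2.1 j (by simp [hj])
      have hv := hker1 (fun j => x3 j1 * (x2 j - x1 j) - x2 j1 * (x3 j - x1 j))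
        (by
          simp only [sub_smul, mul_smul, Finset.sum_sub_distrib, ← Finset.smul_sum, hx1.2.2,
            hx2.2.2, hx3.2.2]
          simp)
        (fun j hj => by simp [o1 j hj, o2 j hj, o3 j hj])
        (by simp only [q1]; ring)
      have P : 0 < x3 j1 := p3 j1 (by simp [hj1, Ne.symm hne.1])
      have Qp : 0 < x2 j1 := p2 j1 (by simp [hj1, Ne.symm hj2.1])
      have e3 := hv j3
      have e2 := hv j2
      simp only [q3, q2] at e3 e2
      have r1 : 0 < x2 j3 := p2 j3 (by simp [hj3, hne.2])
      have r2 : 0 < x1 j3 := p1 j3 (by simp [hj3, hne.1])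
      have r3 : 0 < x3 j2 := p3 j2 (by simp [hj2.2, Ne.symm hne.2])
      have r4 : 0 < x1 j2 := p1 j2 (by simp [hj2.2, hj2.1])
      have c1 : x2 j1 < x3 j1 := by
        by_contra hcon
        push Not at hcon
        have t1 := mul_pos P r1
        have t2 := mul_le_mul_of_nonneg_right hcon r2.le
        linarith
      have t1 := mul_pos Qp r3
      have t2 := mul_lt_mul_of_pos_right c1 r4
      linarith
    · rintro (rfl | rfl)
      · exact ⟨hj1, x1, hx1⟩
      · exact ⟨hj2.2, x2, hx2⟩
  rw [hset, Finset.card_pair (Ne.symm hj2.1)]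
  decide

end Cardinal

section ScarfMain

open Classical in
theorem scarf_generic {I J : Type*} [Fintype I] [Fintype J] (r : I → J → ℕ)
    (hr : ∀ i, Function.Injective (r i)) (e : I → J) (hinj : Function.Injective e)
    (he1 : ∀ i j, j ≠ e i → r i (e i) < r i j)
    (he2 : ∀ i k j, k ≠ i → (∀ l, j ≠ e l) → r i j < r i (e k))
    (hI : 2 ≤ Fintype.card I)
    (a : J → I → ℝ) (ha0 : ∀ j i, 0 ≤ a j i) (ha1 : ∀ j, ∃ i, 1 ≤ a j i)
    (hae : ∀ i, a (e i) = Pi.single i 1)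
    (b : I → ℝ) (hb0 : ∀ i, 0 ≤ b i) (hb : Generic a b) :
    ∃ D, SDom r D ∧ ∃ x, Sol a b D x := by
  by_contra hcon
  push Not at hcon
  have : Nonempty I := Fintype.card_pos_iff.1 (by omega)
  obtain ⟨o⟩ := this
  set P : Finset (Finset J × J) := Finset.univ.filter (fun p =>
    (p.1.card + 1 = Fintype.card I ∧ e o ∉ p.1 ∧ ∃ x, Sol a b (insert (e o) p.1) x) ∧
      (p.2 ∉ p.1 ∧ SDom r (insert p.2 p.1))) with hP
  -- first count
  have hodd : Odd P.card := by
    set 𝒦 : Finset (Finset J) := Finset.univ.filter (fun K =>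
      K.card + 1 = Fintype.card I ∧ e o ∉ K ∧ ∃ x, Sol a b (insert (e o) K) x) with h𝒦
    rw [Finset.card_eq_sum_card_fiberwise (f := Prod.fst) (t := 𝒦)
      (by
        intro p hp
        simp only [hP, Finset.coe_filter, Set.mem_setOf_eq] at hp
        simpa [h𝒦] using hp.2.1)]
    have hfib : ∀ K ∈ 𝒦, (P.filter (fun p => p.1 = K)).card =
        (Finset.univ.filter (fun j => j ∉ K ∧ SDom r (insert j K))).card := by
      intro K hK
      symm
      apply Finset.card_bij (fun j _ => (K, j))
      · intro j hj
        simp only [Finset.mem_filter, Finset.mem_univ, true_and, h𝒦] at hj hK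
        simp only [hP, Finset.mem_filter, Finset.mem_univ, true_and, and_true]
        exact ⟨hK, hj⟩
      · intro j _ j' _ h
        exact (Prod.mk.inj h).2
      · rintro ⟨K', j⟩ hp
        simp only [hP, Finset.mem_filter, Finset.mem_univ, true_and] at hp
        obtain ⟨hp, rfl⟩ := hp
        exact ⟨j, by simpa using hp.2, rfl⟩
    rw [Finset.sum_congr rfl hfib]
    set K0 := (Finset.univ.image e).erase (e o) with hK0
    have hK0mem : K0 ∈ 𝒦 := by
      simp only [h𝒦, Finset.mem_filter, Finset.mem_univ, true_and]
      refine ⟨?_, by simp [hK0], ?_⟩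
      · rw [hK0, Finset.card_erase_of_mem (by simp), Finset.card_image_of_injective _ hinj,
          Finset.card_univ]
        omega
      · rw [hK0, Finset.insert_erase (by simp)]
        refine ⟨fun j => ∑ i, if e i = j then b i else 0, ?_, ?_, ?_⟩
        · intro j
          apply Finset.sum_nonneg
          intro i _
          split_ifs
          · exact hb0 i
          · exact le_rfl
        · intro j hj
          apply Finset.sum_eq_zero
          intro i _
          rw [if_neg]
          rintro rfl
          simp at hj
        · simp only [Finset.sum_smul]
          rw [Finset.sum_comm]
          have : ∀ i, ∑ j, (if e i = j then b i else 0) • a j = b i • Pi.single i (1 : ℝ) := by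
            intro i
            rw [Finset.sum_eq_single (e i)]
            · simp [hae]
            · intro j _ hj
              rw [if_neg (Ne.symm hj), zero_smul]
            · simp
          simp only [this]
          ext i
          simp [Finset.sum_apply, Pi.single_apply]
    rw [← Finset.add_sum_erase _ _ hK0mem]
    apply Odd.add_even
    · exact ord_odd r hr e hinj he1 he2 hI o
    · apply Finset.even_sum
      intro K hK
      rw [Finset.mem_erase] at hK
      obtain ⟨hne, hK⟩ := hK
      simp only [h𝒦, Finset.mem_filter, Finset.mem_univ, true_and] at hK
      obtain ⟨k0, hk0, hk0e⟩ : ∃ k0 ∈ K, ∀ l, k0 ≠ e l := by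
        by_contra h
        push Not at h
        apply hne
        apply Finset.eq_of_subset_of_card_le
        · intro k hk
          obtain ⟨l, rfl⟩ := h k hk
          rw [hK0, Finset.mem_erase]
          exact ⟨fun h' => hK.2.1 (h' ▸ hk), by simp⟩
        · rw [hK0, Finset.card_erase_of_mem (by simp), Finset.card_image_of_injective _ hinj,
            Finset.card_univ]
          omega
      exact ord_even r hr e he2 K hK.1 k0 hk0 hk0e
  -- second count
  have heven : Even P.card := by
    rw [Finset.card_eq_sum_card_fiberwise (f := fun p : Finset J × J => insert p.2 p.1)
      (t := Finset.univ) (by intro p _; simp)]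
    apply Finset.even_sum
    intro D _
    by_cases hD : D.card = Fintype.card I ∧ SDom r D ∧ e o ∉ D
    · obtain ⟨hDc, hDd, hDo⟩ := hD
      have hM : (insert (e o) D).card = Fintype.card I + 1 := by
        rw [Finset.card_insert_of_notMem hDo, hDc]
      have hev := card_even ha0 ha1 hb (insert (e o) D) hM
      have hEr : ∀ j ∈ D, (insert (e o) D).erase j = insert (e o) (D.erase j) := by
        intro j hj
        rw [Finset.erase_insert_of_ne]
        rintro rfl
        exact hDo hj
      have : (P.filter (fun p => insert p.2 p.1 = D)).card =
          ((insert (e o) D).filter (fun j => ∃ x, Sol a b ((insert (e o) D).erase j) x)).card := by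
        apply Finset.card_bij (fun p _ => p.2)
        · rintro ⟨K, j⟩ hp
          simp only [hP, Finset.mem_filter, Finset.mem_univ, true_and] at hp
          obtain ⟨⟨⟨h1, h2, h3⟩, h4, h5⟩, rfl⟩ := hp
          simp only [Finset.mem_filter]
          refine ⟨by simp, ?_⟩
          rw [hEr j (by simp), Finset.erase_insert h4]
          exact h3
        · rintro ⟨K, j⟩ hp ⟨K', j'⟩ hp' h
          simp only [hP, Finset.mem_filter, Finset.mem_univ, true_and] at hp hp' h
          subst h
          have e1 : K = D.erase j := by rw [← hp.2, Finset.erase_insert hp.1.2.1]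
          have e2 : K' = D.erase j := by rw [← hp'.2, Finset.erase_insert hp'.1.2.1]
          rw [e1, e2]
        · intro j hj
          rw [Finset.mem_filter] at hj
          obtain ⟨hj, x, hx⟩ := hj
          have hjo : j ≠ e o := by
            rintro rfl
            rw [Finset.erase_insert hDo] at hx
            exact hcon D hDd x hx
          have hjD : j ∈ D := (Finset.mem_insert.1 hj).resolve_left hjo
          refine ⟨(D.erase j, j), ?_, rfl⟩
          simp only [hP, Finset.mem_filter, Finset.mem_univ, true_and]
          refine ⟨⟨⟨?_, ?_, x, ?_⟩, ?_, ?_⟩, Finset.insert_erase hjD⟩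
          · rw [Finset.card_erase_of_mem hjD]; omega
          · intro h; exact hDo (Finset.mem_of_mem_erase h)
          · rw [← hEr j hjD]; exact hx
          · simp
          · rw [Finset.insert_erase hjD]; exact hDd
      rw [this]
      exact hev
    · have : P.filter (fun p => insert p.2 p.1 = D) = ∅ := by
        rw [Finset.filter_eq_empty_iff]
        rintro ⟨K, j⟩ hp h
        simp only [hP, Finset.mem_filter, Finset.mem_univ, true_and] at hp
        obtain ⟨⟨h1, h2, x, h3⟩, h4, h5⟩ := hp
        simp only at h
        apply hD
        subst h
        refine ⟨by rw [Finset.card_insert_of_notMem h4, h1], h5, ?_⟩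
        intro hmem
        rcases Finset.mem_insert.1 hmem with h | h
        · rw [h] at h3
          exact hcon _ h5 x h3
        · exact h2 h
      rw [this]; simp
  exact (Nat.not_even_iff_odd.2 hodd) heven

theorem generic_dense {I J : Type*} [Fintype I] [Fintype J] (a : J → I → ℝ) :
    Dense {b : I → ℝ | Generic a b} := by
  classical
  have hEq : {b : I → ℝ | Generic a b} =
      ⋂ K : {K : Finset J // Submodule.span ℝ (a '' (K : Set J)) ≠ ⊤},
        ((Submodule.span ℝ (a '' (K.1 : Set J)) : Submodule ℝ (I → ℝ)) : Set (I → ℝ))ᶜ := by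
    ext b
    simp only [Generic, Set.mem_setOf_eq, Set.mem_iInter, Set.mem_compl_iff, SetLike.mem_coe,
      Subtype.forall]
    constructor
    · intro h K hK hb
      exact hK (h K hb)
    · intro h K hb
      by_contra hK
      exact h K hK hb
  rw [hEq]
  apply dense_iInter_of_isOpen
  · intro K
    rw [isOpen_compl_iff]
    exact Submodule.closed_of_finiteDimensional _
  · intro K
    rw [← interior_eq_empty_iff_dense_compl]
    by_contra h
    exact K.2 (Submodule.eq_top_of_nonempty_interior' _ (Set.nonempty_iff_ne_empty.2 h))

theorem scarf {I J : Type*} [Fintype I] [Fintype J] (r : I → J → ℕ)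
    (hr : ∀ i, Function.Injective (r i)) (e : I → J) (hinj : Function.Injective e)
    (he1 : ∀ i j, j ≠ e i → r i (e i) < r i j)
    (he2 : ∀ i k j, k ≠ i → (∀ l, j ≠ e l) → r i j < r i (e k))
    (hI : 2 ≤ Fintype.card I)
    (a : J → I → ℝ) (ha0 : ∀ j i, 0 ≤ a j i) (ha1 : ∀ j, ∃ i, 1 ≤ a j i)
    (hae : ∀ i, a (e i) = by classical exact Pi.single i 1) :
    ∃ D, SDom r D ∧ ∃ x, Sol a (fun _ => 1) D x := by
  classical
  set C : Finset J → Set (J → ℝ) := fun D => Set.Icc (fun _ => (0 : ℝ)) (fun _ => 2) ∩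
    {x | ∀ j, j ∉ D → x j = 0} with hC
  set f : (J → ℝ) → (I → ℝ) := fun x => ∑ j, x j • a j with hf
  have hfc : Continuous f := by
    apply continuous_finsetSum
    intro j _
    exact (continuous_apply j).smul continuous_const
  have hCc : ∀ D, IsCompact (C D) := by
    intro D
    apply isCompact_Icc.inter_right
    simp only [Set.setOf_forall]
    apply isClosed_iInter
    intro j
    apply isClosed_iInter
    intro _
    exact isClosed_eq (continuous_apply j) continuous_const
  set Q : Set (I → ℝ) := ⋃ D : {D : Finset J // SDom r D}, f '' (C D.1) with hQ
  have hQc : IsClosed Q := by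
    apply isClosed_iUnion_of_finite
    intro D
    exact ((hCc D.1).image hfc).isClosed
  set V : Set (I → ℝ) := Set.pi Set.univ (fun _ => Set.Ioo (0 : ℝ) 2) with hV
  have hVo : IsOpen V := isOpen_set_pi Set.finite_univ (fun _ _ => isOpen_Ioo)
  have hsub : V ∩ {b : I → ℝ | Generic a b} ⊆ Q := by
    rintro b ⟨hbV, hb⟩
    simp only [hV, Set.mem_pi, Set.mem_univ, true_implies, Set.mem_Ioo] at hbV
    obtain ⟨D, hD, x, hx⟩ := scarf_generic r hr e hinj he1 he2 hI a ha0 ha1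
      (fun i => by rw [hae i]) b (fun i => (hbV i).1.le) hb
    refine Set.mem_iUnion.2 ⟨⟨D, hD⟩, x, ⟨⟨fun j => hx.1 j, fun j => ?_⟩, hx.2.1⟩, hx.2.2⟩
    obtain ⟨i, hi⟩ := ha1 j
    have h1 := congrFun hx.2.2 i
    simp only [Finset.sum_apply, Pi.smul_apply, smul_eq_mul] at h1
    have h2 := Finset.single_le_sum (f := fun j => x j * a j i)
      (fun j _ => mul_nonneg (hx.1 j) (ha0 j i)) (Finset.mem_univ j)
    beta_reduce at h2
    have h3 := mul_le_mul_of_nonneg_left hi (hx.1 j)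
    have h4 := (hbV i).2
    show x j ≤ 2
    linarith
  have h1V : (fun _ => 1 : I → ℝ) ∈ V := by
    simp [hV]
  have hmem := (generic_dense a).open_subset_closure_inter hVo h1V
  have : (fun _ => 1 : I → ℝ) ∈ Q := by
    rw [← hQc.closure_eq]
    exact closure_mono hsub hmem
  obtain ⟨⟨D, hD⟩, x, hx, hfx⟩ := Set.mem_iUnion.1 this
  exact ⟨D, hD, x, fun j => hx.1.1 j, hx.2, hfx⟩

end ScarfMain

section Final

/-- Potential objections: a nonempty set of types and an affordable set of candidates. -/
def Col {C : Type*} (b : Fin 5 → ℝ) : Type _ :=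
  {p : Finset (Fin 5) × Finset C // p.1.Nonempty ∧ (p.2.card : ℝ) ≤ ∑ t ∈ p.1, b t}

open Classical in
noncomputable instance {C : Type*} [Fintype C] (b : Fin 5 → ℝ) : Fintype (Col (C := C) b) := by
  unfold Col; infer_instance

open Classical in
/-- utility of row `i` for column `s`. -/
noncomputable def colVal {C : Type*} [Fintype C] (Dt : Fin 5 → Finset C) (b : Fin 5 → ℝ) (i : Fin 5)
    (s : Col (C := C) b) : ℕ :=
  if i ∈ s.1.1 then (Dt i ∩ s.1.2).card else Fintype.card C + 1

theorem colVal_le {C : Type*} [Fintype C] (Dt : Fin 5 → Finset C) (b : Fin 5 → ℝ) (i : Fin 5)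
    (s : Col (C := C) b) : colVal Dt b i s ≤ Fintype.card C + 1 := by
  unfold colVal
  split_ifs
  · exact (Finset.card_le_univ _).trans (Nat.le_succ _)
  · exact le_rfl

/-- The rank functions. -/
noncomputable def colRank {C : Type*} [Fintype C] (Dt : Fin 5 → Finset C) (b : Fin 5 → ℝ) (i : Fin 5) :
    Fin 5 ⊕ Col (C := C) b → ℕ
  | Sum.inl k => if k = i then 0 else
      (Fintype.card C + 2) * Fintype.card (Col (C := C) b) + 1 + k
  | Sum.inr s => colVal Dt b i s * Fintype.card (Col (C := C) b)
      + (Fintype.equivFin (Col (C := C) b) s : ℕ) + 1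

theorem colRank_inr_lt {C : Type*} [Fintype C] (Dt : Fin 5 → Finset C) (b : Fin 5 → ℝ) (i : Fin 5)
    (s : Col (C := C) b) : colRank Dt b i (Sum.inr s) <
      (Fintype.card C + 2) * Fintype.card (Col (C := C) b) + 1 := by
  have h1 := colVal_le Dt b i s
  have h2 := (Fintype.equivFin (Col (C := C) b) s).2
  have h3 := Nat.mul_le_mul_right (Fintype.card (Col (C := C) b)) h1
  simp only [colRank]
  have : (Fintype.card C + 2) * Fintype.card (Col (C := C) b) =
    (Fintype.card C + 1) * Fintype.card (Col (C := C) b) + Fintype.card (Col (C := C) b) := by ring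
  omega

theorem colRank_inr_le {C : Type*} [Fintype C] (Dt : Fin 5 → Finset C) (b : Fin 5 → ℝ) (i : Fin 5)
    (s s' : Col (C := C) b) (h : colRank Dt b i (Sum.inr s) ≤ colRank Dt b i (Sum.inr s')) :
    colVal Dt b i s ≤ colVal Dt b i s' := by
  by_contra hlt
  have hlt : colVal Dt b i s' + 1 ≤ colVal Dt b i s := by omega
  have h3 := Nat.mul_le_mul_right (Fintype.card (Col (C := C) b)) hlt
  have h2 := (Fintype.equivFin (Col (C := C) b) s').2
  simp only [colRank] at h
  rw [Nat.add_mul] at h3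
  omega

theorem colRank_inj {C : Type*} [Fintype C] (Dt : Fin 5 → Finset C) (b : Fin 5 → ℝ) (i : Fin 5) :
    Function.Injective (colRank Dt b i) := by
  rintro (k | s) (k' | s') h
  · simp only [colRank] at h
    split_ifs at h with h1 h2 h2
    · rw [h1, h2]
    · omega
    · omega
    · congr 1
      apply Fin.ext
      omega
  · exfalso
    have := colRank_inr_lt Dt b i s'
    rw [← h] at this
    simp only [colRank] at this h
    split_ifs at this h with h1
    omega
  · exfalso
    have := colRank_inr_lt Dt b i s
    rw [h] at this
    simp only [colRank] at this h
    split_ifs at this h with h1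
    omega
  · have e := le_antisymm (colRank_inr_le Dt b i s s' h.le) (colRank_inr_le Dt b i s' s h.ge)
    simp only [colRank, e] at h
    congr 1
    apply (Fintype.equivFin _).injective
    apply Fin.ext
    omega

open Classical in
theorem frac_core {C : Type*} [Fintype C] (Dt : Fin 5 → Finset C) (b : Fin 5 → ℝ)
    (hb : ∀ i, 0 ≤ b i) :
    ∃ (m : Fin 5 → ℕ) (y : C → ℝ), (∀ c, 0 ≤ y c) ∧ (∀ c, y c ≤ 1) ∧ (∑ c, y c ≤ ∑ i, b i) ∧
      (∀ i, (m i : ℝ) ≤ ∑ c ∈ Dt i, y c) ∧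
      ∀ (S : Finset (Fin 5)) (T : Finset C), S.Nonempty → (T.card : ℝ) ≤ ∑ t ∈ S, b t →
        ∃ i ∈ S, (Dt i ∩ T).card ≤ m i := by
  set a : Fin 5 ⊕ Col (C := C) b → Fin 5 → ℝ := fun j =>
    match j with
    | Sum.inl k => Pi.single k 1
    | Sum.inr s => fun i => if i ∈ s.1.1 then 1 else 0 with ha
  obtain ⟨D, hD, x, hx0, hxD, hx⟩ := scarf (colRank Dt b) (colRank_inj Dt b) Sum.inl
    Sum.inl_injective
    (by
      rintro i (k | s) hj
      · have : k ≠ i := fun h => hj (by rw [h])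
        simp [colRank, this]
      · simp [colRank])
    (by
      rintro i k (l | s) hk hl
      · exact absurd rfl (hl l)
      · have := colRank_inr_lt Dt b i s
        refine this.trans_le ?_
        simp [colRank, hk])
    (by simp) a
    (by
      rintro (k | s) i
      · simp only [ha, Pi.single_apply]; split_ifs <;> norm_num
      · simp only [ha]; split_ifs <;> norm_num)
    (by
      rintro (k | s)
      · exact ⟨k, by simp [ha]⟩
      · obtain ⟨i, hi⟩ := s.2.1
        exact ⟨i, by simp [ha, hi]⟩)
    (by intro i; simp only [ha]; congr!)
  set w : Col (C := C) b → ℝ := fun s => x (Sum.inr s) with hw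
  have hw0 : ∀ s, 0 ≤ w s := fun s => hx0 _
  have hrow : ∀ i, x (Sum.inl i) + ∑ s, w s * (if i ∈ s.1.1 then 1 else 0) = 1 := by
    intro i
    have h := congrFun hx i
    simp only [Finset.sum_apply, Pi.smul_apply, smul_eq_mul, Fintype.sum_sum_type] at h
    simpa [ha, Pi.single_apply] using h
  have hrow1 : ∀ i, ∑ s, w s * (if i ∈ s.1.1 then 1 else 0) ≤ 1 := fun i => by
    have := hrow i
    have := hx0 (Sum.inl i)
    linarith
  set M : Fin 5 → Set ℕ := fun i =>
    {n | ∃ s : Col (C := C) b, Sum.inr s ∈ D ∧ i ∈ s.1.1 ∧ n = (Dt i ∩ s.1.2).card} with hM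
  set m : Fin 5 → ℕ := fun i => if Sum.inl i ∈ D then 0 else sInf (M i) with hm
  set Y : C → ℝ := fun c => ∑ s, w s * (if c ∈ s.1.2 then 1 else 0) with hY
  have hY0 : ∀ c, 0 ≤ Y c := fun c => Finset.sum_nonneg (fun s _ =>
    mul_nonneg (hw0 s) (by split_ifs <;> norm_num))
  refine ⟨m, fun c => min 1 (Y c), fun c => le_min zero_le_one (hY0 c), fun c => min_le_left _ _,
    ?_, ?_, ?_⟩
  · calc ∑ c, min 1 (Y c) ≤ ∑ c, Y c := Finset.sum_le_sum (fun c _ => min_le_right _ _)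
      _ = ∑ s, w s * (s.1.2.card : ℝ) := by
        simp only [hY]
        rw [Finset.sum_comm]
        refine Finset.sum_congr rfl (fun s _ => ?_)
        rw [← Finset.mul_sum]
        simp
      _ ≤ ∑ s, w s * ∑ t ∈ s.1.1, b t :=
        Finset.sum_le_sum (fun s _ => mul_le_mul_of_nonneg_left s.2.2 (hw0 s))
      _ = ∑ s, ∑ t, b t * (w s * (if t ∈ s.1.1 then 1 else 0)) := by
        refine Finset.sum_congr rfl (fun s _ => ?_)
        rw [Finset.mul_sum, ← Finset.sum_filter_add_sum_filter_not Finset.univ (· ∈ s.1.1)]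
        rw [Finset.sum_eq_zero (s := Finset.univ.filter (fun t => ¬ t ∈ s.1.1))]
        · rw [add_zero, Finset.filter_univ_mem]
          refine Finset.sum_congr rfl (fun t ht => ?_)
          rw [if_pos ht]; ring
        · intro t ht
          rw [if_neg (Finset.mem_filter.1 ht).2]; ring
      _ = ∑ t, b t * ∑ s, w s * (if t ∈ s.1.1 then 1 else 0) := by
        rw [Finset.sum_comm]
        refine Finset.sum_congr rfl (fun s _ => ?_)
        rw [← Finset.mul_sum]
      _ ≤ ∑ t, b t := by
        refine Finset.sum_le_sum (fun t _ => ?_)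
        have := mul_le_mul_of_nonneg_left (hrow1 t) (hb t)
        linarith
  · intro i
    by_cases hi : Sum.inl i ∈ D
    · simp only [hm, if_pos hi]
      rw [Nat.cast_zero]
      exact Finset.sum_nonneg (fun c _ => le_min zero_le_one (hY0 c))
    · have h1 := hrow i
      rw [hxD _ hi, zero_add] at h1
      calc (m i : ℝ) = ∑ s, (w s * (if i ∈ s.1.1 then 1 else 0)) * m i := by
            rw [← Finset.sum_mul, h1, one_mul]
        _ ≤ ∑ s, (w s * (if i ∈ s.1.1 then 1 else 0)) * ((Dt i ∩ s.1.2).card : ℝ) := by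
            refine Finset.sum_le_sum (fun s _ => ?_)
            by_cases hs : Sum.inr s ∈ D
            · by_cases his : i ∈ s.1.1
              · refine mul_le_mul_of_nonneg_left ?_ (mul_nonneg (hw0 s) (by split_ifs; norm_num))
                simp only [hm, if_neg hi]
                have hmem : (Dt i ∩ s.1.2).card ∈ M i := ⟨s, hs, his, rfl⟩
                exact_mod_cast Nat.sInf_le hmem
              · simp [his]
            · have : w s = 0 := hxD _ hs
              simp [this]
        _ = ∑ c ∈ Dt i, ∑ s, (w s * (if i ∈ s.1.1 then 1 else 0)) * (if c ∈ s.1.2 then 1 else 0) := by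
            rw [Finset.sum_comm]
            refine Finset.sum_congr rfl (fun s _ => ?_)
            rw [← Finset.mul_sum]
            congr 1
            rw [Finset.sum_boole, Finset.filter_mem_eq_inter]
        _ ≤ ∑ c ∈ Dt i, min 1 (Y c) := by
            refine Finset.sum_le_sum (fun c _ => le_min ?_ ?_)
            · refine le_trans (Finset.sum_le_sum (fun s _ => ?_)) (hrow1 i)
              have : 0 ≤ w s * (if i ∈ s.1.1 then 1 else 0) :=
                mul_nonneg (hw0 s) (by split_ifs <;> norm_num)
              split_ifs at this ⊢ <;> linarith
            · refine Finset.sum_le_sum (fun s _ => ?_)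
              have := hw0 s
              split_ifs <;> linarith
  · intro S T hS hT
    set s0 : Col (C := C) b := ⟨(S, T), hS, hT⟩ with hs0
    obtain ⟨i, hi⟩ := hD (Sum.inr s0)
    have hiD : Sum.inl i ∉ D := by
      intro h
      have := hi _ h
      simp [colRank] at this
    have h1 := hrow i
    rw [hxD _ hiD, zero_add] at h1
    have hne : (M i).Nonempty := by
      by_contra hcon
      rw [Set.not_nonempty_iff_eq_empty] at hcon
      rw [Finset.sum_eq_zero] at h1
      · exact zero_ne_one h1
      · intro s _
        by_cases hs : Sum.inr s ∈ D
        · by_cases his : i ∈ s.1.1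
          · have : (Dt i ∩ s.1.2).card ∈ M i := ⟨s, hs, his, rfl⟩
            rw [hcon] at this
            exact absurd this (Set.notMem_empty _)
          · simp [his]
        · have : w s = 0 := hxD _ hs
          simp [this]
    obtain ⟨s, hs, his, hmin⟩ := Nat.sInf_mem hne
    have h2 := colRank_inr_le Dt b i s0 s (hi _ hs)
    simp only [colVal, if_pos his] at h2
    have h3 : (Dt i ∩ s.1.2).card ≤ Fintype.card C := Finset.card_le_univ _
    have hiS : i ∈ s0.1.1 := by
      by_contra hcon
      rw [if_neg hcon] at h2
      omega
    rw [if_pos hiS] at h2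
    refine ⟨i, hiS, ?_⟩
    simp only [hm, if_neg hiD]
    rw [hmin]
    exact h2

end Final

/-- For any approval profile with at most 5 distinct approval sets and any
committee size `k`, there exists a committee `W` of size at most `k` in the
core: no non-empty coalition `S` has an objection `T` with
`|T| ≤ (|S| / |N̂|) · k` that every member of `S` strictly prefers. -/
theorem stmt16 (V C : Type*) [Fintype V] [DecidableEq V] [Fintype C] [DecidableEq C]
    (A : V → Finset C) (k : ℕ)
    (htypes : (Finset.univ.image A).card ≤ 5) :
    ∃ W : Finset C, W.card ≤ k ∧
      ¬ ∃ (S : Finset V) (T : Finset C), S.Nonempty ∧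
          ((T.card : ℚ) ≤ ((S.card : ℚ) / (Fintype.card V : ℚ)) * (k : ℚ)) ∧
          ∀ i ∈ S, (A i ∩ W).card < (A i ∩ T).card := by
  rcases isEmpty_or_nonempty V with hV | hV
  · refine ⟨∅, by simp, ?_⟩
    rintro ⟨S, T, ⟨v, _⟩, _⟩
    exact hV.elim v
  obtain ⟨τ, Dt, hτ⟩ : ∃ (τ : V → Fin 5) (Dt : Fin 5 → Finset C), ∀ v, A v = Dt (τ v) := by
    set X := Finset.univ.image A with hX
    set f : X → Fin 5 := fun z => Fin.castLE htypes (X.equivFin z) with hf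
    have hfi : Function.Injective f :=
      (Fin.castLE_injective htypes).comp X.equivFin.injective
    have hmem : ∀ v, A v ∈ X := fun v => Finset.mem_image_of_mem A (Finset.mem_univ v)
    refine ⟨fun v => f ⟨A v, hmem v⟩, Function.extend f (fun z => z.1) (fun _ => ∅), fun v => ?_⟩
    rw [hfi.extend_apply]
  have hn : (0 : ℝ) < Fintype.card V := by exact_mod_cast Fintype.card_pos
  set q : ℝ := (k : ℝ) / Fintype.card V with hq
  have hq0 : 0 ≤ q := div_nonneg (Nat.cast_nonneg _) hn.le
  set b : Fin 5 → ℝ := fun t => ((Finset.univ.filter (fun v => τ v = t)).card : ℝ) * q with hb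
  have hbs : ∑ t, b t = k := by
    simp only [hb]
    rw [← Finset.sum_mul, ← Nat.cast_sum,
      ← Finset.card_eq_sum_card_fiberwise (f := τ) (fun x _ => Finset.mem_coe.2 (Finset.mem_univ _)),
      Finset.card_univ, hq]
    exact mul_div_cancel₀ _ hn.ne'
  obtain ⟨m, y, hy0, hy1, hys, hym, hcore⟩ := frac_core Dt b
    (fun t => mul_nonneg (Nat.cast_nonneg _) hq0)
  obtain ⟨W, hWk, hW⟩ := rounding Dt (fun i => (m i : ℤ)) k y hy0 hy1 (hys.trans hbs.le)
    (fun i => by simpa using hym i)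
  refine ⟨W, hWk, ?_⟩
  rintro ⟨S, T, hS, hT, hblock⟩
  have hT' : (T.card : ℝ) ≤ ((S.card : ℝ) / (Fintype.card V : ℝ)) * (k : ℝ) := by exact_mod_cast hT
  have hTb : (T.card : ℝ) ≤ ∑ t ∈ S.image τ, b t := by
    have h1 : S.card ≤ ∑ t ∈ S.image τ, (Finset.univ.filter (fun v => τ v = t)).card := by
      rw [Finset.card_eq_sum_card_image τ S]
      exact Finset.sum_le_sum (fun t _ =>
        Finset.card_le_card (Finset.filter_subset_filter _ (Finset.subset_univ _)))
    have h2 : (S.card : ℝ) ≤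
        ∑ t ∈ S.image τ, ((Finset.univ.filter (fun v => τ v = t)).card : ℝ) := by
      exact_mod_cast h1
    have h3 := mul_le_mul_of_nonneg_right h2 hq0
    simp only [hb]
    rw [← Finset.sum_mul]
    refine le_trans (hT'.trans (le_of_eq ?_)) h3
    rw [hq]; ring
  obtain ⟨i, hiS, hi⟩ := hcore (S.image τ) T (hS.image τ) hTb
  obtain ⟨v, hv, rfl⟩ := Finset.mem_image.1 hiS
  have h1 := hblock v hv
  have h2 := hW (τ v)
  rw [hτ v] at h1
  have e1 : (Dt (τ v) ∩ W).card = (@Inter.inter _ (@Finset.instInter C (fun a b => Classical.propDecidable (a = b))) W (Dt (τ v))).card := by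
    rw [Finset.inter_comm]; congr!
  have e2 : (Dt (τ v) ∩ T).card ≤ m (τ v) := by
    convert hi
  rw [e1] at h1
  have h3 := Int.ofNat_le.1 h2
  exact absurd (h1.trans_le (e2.trans h3)) (lt_irrefl _)
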